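/- arXiv:2404.02341 — 2 statements merged into one kernel-verified Lean document; each statement's English description precedes it below -/
import Mathlib

section
/- Let g be a frice homeomorphism of T². Then for every ε > 0 there exists a positive integer n_ε such that every continuum K̂ ⊂ ℝ² with diam(K̂) ≥ ε admits an integer n with |n| ≤ n_ε and diam(ĝ^n(K̂)) > 3ε, where ĝ is a lift of g. -/
open Metric Filter Topology MeasureTheory Set ENNReal

noncomputable section

abbrev R2 : Type := ℝ × ℝ

abbrev Torus : Type := AddCircle (1 : ℝ) × AddCircle (1 : ℝ)

instance : Fact ((0:ℝ) < 1) := ⟨one_pos⟩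

/-- The covering projection `ℝ² → T²`. -/
def proj : R2 → Torus := fun p => ((p.1 : AddCircle (1:ℝ)), (p.2 : AddCircle (1:ℝ)))

/-- `F : ℝ² → ℝ²` is a lift of `f : T² → T²` (commutes with the projection and
with the integer translations). -/
def IsLiftFun (f : Torus → Torus) (F : R2 → R2) : Prop :=
  (∀ x : R2, proj (F x) = f (proj x)) ∧
  ∀ (x : R2) (v : ℤ × ℤ), F (x + ((v.1 : ℝ), (v.2 : ℝ))) = F x + ((v.1 : ℝ), (v.2 : ℝ))

/-- Iteration of a homeomorphism indexed by `ℤ`. -/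
def iterZ {X : Type*} [TopologicalSpace X] (F : X ≃ₜ X) : ℤ → X → X
  | Int.ofNat n => (⇑F)^[n]
  | Int.negSucc n => (⇑F.symm)^[n+1]

/-- The rotation set of a lift. -/
def rotSet (F : R2 ≃ₜ R2) : Set R2 :=
  {v | ∃ (z : ℕ → R2) (n : ℕ → ℕ), Tendsto n atTop atTop ∧
    Tendsto (fun k => ((n k : ℝ))⁻¹ • ((⇑F)^[n k] (z k) - z k)) atTop (nhds v)}

/-- A continuum: a nonempty compact connected set. -/
def IsContinuum {X : Type*} [TopologicalSpace X] (K : Set X) : Prop :=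
  IsCompact K ∧ IsConnected K

/-- Dynamical diameter of a set under a homeomorphism of the plane. -/
def dynDiam (F : R2 ≃ₜ R2) (K : Set R2) : ℝ≥0∞ :=
  ⨆ j : ℤ, EMetric.diam (iterZ F j '' K)

/-- Topological mixing. -/
def TopologicallyMixing {X : Type*} [TopologicalSpace X] (h : X → X) : Prop :=
  ∀ U V : Set X, IsOpen U → IsOpen V → U.Nonempty → V.Nonempty →
    ∃ n₀ : ℕ, ∀ n, n₀ ≤ n → ((h^[n]) '' U ∩ V).Nonempty

/-- Maximal cardinality of a `(±n, ε)`-separated subset of `K`. -/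
def sepCount (g : Torus ≃ₜ Torus) (n : ℕ) (ε : ℝ) (K : Set Torus) : ℕ :=
  sSup {m : ℕ | ∃ Y : Finset Torus, ↑Y ⊆ K ∧ Y.card = m ∧
    ∀ y ∈ Y, ∀ y' ∈ Y, y ≠ y' →
      ∃ i : ℤ, |i| ≤ (n : ℤ) ∧ ε < dist (iterZ g i y) (iterZ g i y')}

/-- The two-sided entropy `h_±(g, K)` carried by `K`. -/
def entropyPM (g : Torus ≃ₜ Torus) (K : Set Torus) : EReal :=
  ⨆ (ε : ℝ) (_ : 0 < ε),
    limsup (fun n : ℕ => ((Real.log (sepCount g n ε K) / n : ℝ) : EReal)) atTop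

/-- Connected component of the `ε`-stable set of `z` containing `z`. -/
def stableComp (G : R2 ≃ₜ R2) (ε : ℝ) (z : R2) : Set R2 :=
  connectedComponentIn {z' : R2 | ∀ j : ℕ, dist ((⇑G)^[j] z') ((⇑G)^[j] z) ≤ ε} z

/-- The stable set of `z`. -/
def stableSet (G : R2 ≃ₜ R2) (z : R2) : Set R2 := ⋃ ε > 0, stableComp G ε z

/-- Connected component of the `ε`-unstable set of `z` containing `z`. -/
def unstableComp (G : R2 ≃ₜ R2) (ε : ℝ) (z : R2) : Set R2 :=
  connectedComponentIn {z' : R2 | ∀ j : ℕ, dist ((⇑G.symm)^[j] z') ((⇑G.symm)^[j] z) ≤ ε} z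

/-- The unstable set of `z`. -/
def unstableSet (G : R2 ≃ₜ R2) (z : R2) : Set R2 := ⋃ ε > 0, unstableComp G ε z

/-- Two points are dynamically related if some dynamically bounded continuum contains both. -/
def dynRel (F : R2 ≃ₜ R2) (z z' : R2) : Prop :=
  ∃ K : Set R2, IsContinuum K ∧ z ∈ K ∧ z' ∈ K ∧ dynDiam F K ≠ ⊤

/-- The equivalence class of `z` under the dynamically-bounded relation. -/
def dynClass (F : R2 ≃ₜ R2) (z : R2) : Set R2 := {z' | dynRel F z z'}


/-- Lower limit of a sequence of sets along an ultrafilter. -/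
def ulim (K : ℕ → Set R2) : Set R2 :=
  {x | ∀ U : Set R2, IsOpen U → x ∈ U → ∀ᶠ n in (hyperfilter ℕ : Filter ℕ), (K n ∩ U).Nonempty}

theorem ulim_of_seq {C : Set R2} (hC : IsCompact C) (u : ℕ → R2)
    (hu : ∀ᶠ n in (hyperfilter ℕ : Filter ℕ), u n ∈ C) :
    ∃ x ∈ C, Tendsto u (hyperfilter ℕ : Filter ℕ) (𝓝 x) := by
  obtain ⟨x, hx, h⟩ := hC.ultrafilter_le_nhds ((hyperfilter ℕ).map u)
    (by rw [le_principal_iff]; exact hu)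
  exact ⟨x, hx, h⟩

theorem mem_ulim_of_tendsto {K : ℕ → Set R2} {u : ℕ → R2} {x : R2}
    (hu : ∀ᶠ n in (hyperfilter ℕ : Filter ℕ), u n ∈ K n)
    (hx : Tendsto u (hyperfilter ℕ : Filter ℕ) (𝓝 x)) : x ∈ ulim K := by
  intro U hU hxU
  filter_upwards [hu, hx (hU.mem_nhds hxU)] with n h1 h2
  exact ⟨u n, h1, h2⟩

theorem isClosed_ulim (K : ℕ → Set R2) : IsClosed (ulim K) := by
  rw [← closure_subset_iff_isClosed]
  intro x hx U hU hxU
  obtain ⟨y, hyU, hy⟩ := mem_closure_iff.1 hx U hU hxU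
  exact hy U hU hyU

theorem ulim_subset {K : ℕ → Set R2} {C : Set R2} (hC : IsClosed C) (h : ∀ n, K n ⊆ C) :
    ulim K ⊆ C := by
  intro x hx
  by_contra hxC
  obtain ⟨n, y, hy, hyC⟩ := (hx Cᶜ hC.isOpen_compl hxC).exists
  exact hyC (h n hy)

theorem isPreconnected_ulim {K : ℕ → Set R2} {C : Set R2} (hC : IsCompact C)
    (h : ∀ n, K n ⊆ C) (hK : ∀ n, IsPreconnected (K n)) : IsPreconnected (ulim K) := by
  rw [isPreconnected_iff_subset_of_fully_disjoint_closed (isClosed_ulim K)]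
  intro A B hA hB hAB hd
  obtain ⟨U, V, hU, hV, hAU, hBV, hUV⟩ := normal_separation hA hB hd
  by_contra hcon
  push Not at hcon
  obtain ⟨hnA, hnB⟩ := hcon
  obtain ⟨b, hb, hbA⟩ := not_subset.1 hnA
  obtain ⟨a, ha, haB⟩ := not_subset.1 hnB
  have hbV : b ∈ V := hBV ((hAB hb).resolve_left hbA)
  have haU : a ∈ U := hAU ((hAB ha).resolve_right haB)
  have hsub : ∀ᶠ n in (hyperfilter ℕ : Filter ℕ), K n ⊆ U ∪ V := by
    by_contra hns
    have hns' : ∀ᶠ n in (hyperfilter ℕ : Filter ℕ), ¬ (K n ⊆ U ∪ V) :=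
      Ultrafilter.eventually_not.2 hns
    have : ∀ n, ∃ x : R2, ¬ (K n ⊆ U ∪ V) → x ∈ K n ∧ x ∉ U ∪ V := by
      intro n
      by_cases hn : K n ⊆ U ∪ V
      · exact ⟨0, fun h' => absurd hn h'⟩
      · obtain ⟨x, hx⟩ := not_subset.1 hn
        exact ⟨x, fun _ => hx⟩
    choose u hu using this
    obtain ⟨x, -, hx⟩ := ulim_of_seq hC u (hns'.mono fun n hn => h n (hu n hn).1)
    have hxL : x ∈ ulim K := mem_ulim_of_tendsto (hns'.mono fun n hn => (hu n hn).1) hx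
    have hxUV : x ∈ U ∪ V := union_subset_union hAU hBV (hAB hxL)
    obtain ⟨n, hn1, hn2⟩ := (hns'.and (hx ((hU.union hV).mem_nhds hxUV))).exists
    exact (hu n hn1).2 hn2
  obtain ⟨n, h1, h2, h3⟩ := (hsub.and ((ha U hU haU).and (hb V hV hbV))).exists
  obtain ⟨z, -, hz⟩ := hK n U V hU hV h1 h2 h3
  exact disjoint_left.1 hUV hz.1 hz.2

theorem continuous_iterZ (G : R2 ≃ₜ R2) (j : ℤ) : Continuous (iterZ G j) := by
  cases j with
  | ofNat n => exact G.continuous.iterate n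
  | negSucc n => exact G.symm.continuous.iterate (n + 1)

theorem iterate_add_const {F : R2 → R2} {w : R2} (h : ∀ x, F (x + w) = F x + w) (n : ℕ) (x : R2) :
    F^[n] (x + w) = F^[n] x + w := by
  induction n generalizing x with
  | zero => rfl
  | succ n ih => rw [Function.iterate_succ_apply, Function.iterate_succ_apply, h, ih]

theorem iterZ_add (G : R2 ≃ₜ R2) {w : R2} (h : ∀ x, G (x + w) = G x + w) (j : ℤ) (x : R2) :
    iterZ G j (x + w) = iterZ G j x + w := by
  cases j with
  | ofNat n => exact iterate_add_const h n x
  | negSucc n =>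
    refine iterate_add_const (fun y => ?_) (n + 1) x
    rw [G.symm_apply_eq, h, G.apply_symm_apply]

/-- **Uniform continuum-wise expansivity.** For a frice homeomorphism and any `ε > 0`, there
is `n_ε` such that any continuum of diameter at least `ε` has some iterate, within time
`n_ε`, of diameter greater than `3ε`. -/
theorem frice_uniform_expansivity
    (g : Torus ≃ₜ Torus) (G : R2 ≃ₜ R2) (hG : IsLiftFun ⇑g ⇑G)
    (hrot : (interior (rotSet G)).Nonempty)
    (hexp : ∀ K : Set R2, IsContinuum K → K.Nontrivial → dynDiam G K = ⊤)
    (ε : ℝ) (hε : 0 < ε) :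
    ∃ nε : ℕ, 0 < nε ∧ ∀ K : Set R2, IsContinuum K →
      ENNReal.ofReal ε ≤ EMetric.diam K →
      ∃ n : ℤ, |n| ≤ (nε : ℤ) ∧
        ENNReal.ofReal (3 * ε) < EMetric.diam (iterZ G n '' K) := by
  by_contra hcon
  push Not at hcon
  -- normalised bad continua
  have key : ∀ n : ℕ, ∃ (K : Set R2) (p q r : R2), IsPreconnected K ∧ p ∈ K ∧ q ∈ K ∧
      ENNReal.ofReal (ε / 2) < edist p q ∧ r ∈ K ∧ dist r 0 ≤ 1 ∧
      ∀ j : ℤ, |j| ≤ (n : ℤ) → ∀ x ∈ K, ∀ y ∈ K, dist (iterZ G j x) (iterZ G j y) ≤ 3 * ε := by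
    intro n
    obtain ⟨K, hK, hd, hj⟩ := hcon (n + 1) (Nat.succ_pos n)
    obtain ⟨p, hp, q, hq, hpq⟩ : ∃ p ∈ K, ∃ q ∈ K, ENNReal.ofReal (ε / 2) < edist p q := by
      by_contra hno
      push Not at hno
      have h1 : EMetric.diam K ≤ ENNReal.ofReal (ε / 2) :=
        EMetric.diam_le fun x hx y hy => hno x hx y hy
      have h2 := hd.trans h1
      rw [ENNReal.ofReal_le_ofReal_iff (by positivity)] at h2
      linarith
    have hcomm := fun x => hG.2 x (-⌊p.1⌋, -⌊p.2⌋)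
    set w : R2 := (((-⌊p.1⌋ : ℤ) : ℝ), ((-⌊p.2⌋ : ℤ) : ℝ)) with hw
    refine ⟨(fun x => x + w) '' K, p + w, q + w, p + w,
      hK.2.isPreconnected.image _ (by fun_prop), mem_image_of_mem _ hp, mem_image_of_mem _ hq,
      by simpa using hpq, mem_image_of_mem _ hp, ?_, ?_⟩
    · rw [Prod.dist_eq, max_le_iff]
      have e1 : (p + w).1 = Int.fract p.1 := by
        simp [hw, Int.fract, sub_eq_add_neg]
      have e2 : (p + w).2 = Int.fract p.2 := by
        simp [hw, Int.fract, sub_eq_add_neg]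
      rw [e1, e2]
      simp only [Prod.fst_zero, Prod.snd_zero, Real.dist_eq, sub_zero, Int.abs_fract]
      exact ⟨(Int.fract_lt_one _).le, (Int.fract_lt_one _).le⟩
    · rintro j hjn _ ⟨x, hx, rfl⟩ _ ⟨y, hy, rfl⟩
      have h1 := hj j (by push_cast; linarith)
      have h2 := (EMetric.edist_le_diam_of_mem (mem_image_of_mem (iterZ G j) hx)
        (mem_image_of_mem (iterZ G j) hy)).trans h1
      simp only [iterZ_add G hcomm, dist_add_right]
      rw [edist_dist, ENNReal.ofReal_le_ofReal_iff (by positivity)] at h2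
      exact h2
  choose K p q r hpre hp hq hpq hr hr1 hb using key
  have hC : IsCompact (closedBall (0 : R2) (3 * ε + 1)) := isCompact_closedBall _ _
  have hKC : ∀ n, K n ⊆ closedBall (0 : R2) (3 * ε + 1) := by
    intro n x hx
    have h1 : dist x (r n) ≤ 3 * ε := hb n 0 (by simp) x hx (r n) (hr n)
    have h2 := dist_triangle x (r n) 0
    have h3 := hr1 n
    rw [mem_closedBall]
    linarith
  obtain ⟨a, -, ha⟩ := ulim_of_seq hC p (Eventually.of_forall fun n => hKC n (hp n))
  obtain ⟨b, -, hb'⟩ := ulim_of_seq hC q (Eventually.of_forall fun n => hKC n (hq n))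
  have haL : a ∈ ulim K := mem_ulim_of_tendsto (Eventually.of_forall hp) ha
  have hbL : b ∈ ulim K := mem_ulim_of_tendsto (Eventually.of_forall hq) hb'
  have hab : a ≠ b := by
    rintro rfl
    have h1 := ge_of_tendsto (ha.edist hb') (Eventually.of_forall fun n => (hpq n).le)
    rw [edist_self, nonpos_iff_eq_zero, ENNReal.ofReal_eq_zero] at h1
    linarith
  have htop := hexp (ulim K)
    ⟨hC.of_isClosed_subset (isClosed_ulim K) (ulim_subset hC.isClosed hKC),
      ⟨a, haL⟩, isPreconnected_ulim hC hKC hpre⟩ ⟨a, haL, b, hbL, hab⟩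
  have hle : dynDiam G (ulim K) ≤ ENNReal.ofReal (3 * ε) := by
    refine iSup_le fun j => EMetric.diam_le ?_
    rintro _ ⟨x, hx, rfl⟩ _ ⟨y, hy, rfl⟩
    rw [edist_dist]
    apply ENNReal.ofReal_le_ofReal
    by_contra hlt
    push Not at hlt
    have hcont := continuous_iterZ G j
    have hop : IsOpen {z : R2 × R2 | 3 * ε < dist (iterZ G j z.1) (iterZ G j z.2)} :=
      isOpen_lt continuous_const (by fun_prop)
    obtain ⟨U, V, hU, hV, hxU, hyV, hsub⟩ := isOpen_prod_iff.1 hop x y hlt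
    have hge : ∀ᶠ n in (hyperfilter ℕ : Filter ℕ), j.natAbs ≤ n :=
      (Nat.hyperfilter_le_atTop) (eventually_ge_atTop j.natAbs)
    obtain ⟨n, ⟨x', hx', hxU'⟩, ⟨y', hy', hyV'⟩, hn⟩ :=
      ((hx U hU hxU).and ((hy V hV hyV).and hge)).exists
    have h1 := hb n j (by rw [Int.abs_eq_natAbs]; exact_mod_cast hn) x' hx' y' hy'
    have h2 : 3 * ε < dist (iterZ G j x') (iterZ G j y') := hsub (mk_mem_prod hxU' hyV')
    linarith
  rw [htop] at hle
  exact ENNReal.ofReal_ne_top (top_le_iff.1 hle)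
end
end

section
/- Let ĝ be a lift of a frice homeomorphism g of T², and fix d > 0. Then there exists L_d > 0 such that every stable continuum K̂ ⊂ ℝ² with diam(K̂) > L_d satisfies diam(ĝ^j(K̂)) > d for every integer j < 0. -/
open Metric Filter Topology MeasureTheory Set ENNReal

noncomputable section

section GenTop
variable {α : Type*} [MetricSpace α]

lemma aux_sep {S E F : Set α} (hS : IsCompact S) (hE : IsClosed E) (hF : IsClosed F)
    (hES : E ⊆ S)
    (h : ∀ C ⊆ S, IsPreconnected C → (C ∩ E).Nonempty → (C ∩ F).Nonempty → False) :
    ∃ C1 C2 : Set α, IsClosed C1 ∧ IsClosed C2 ∧ Disjoint C1 C2 ∧ C1 ∪ C2 = S ∧ E ⊆ C1 ∧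
      Disjoint C1 F := by
  have : CompactSpace S := isCompact_iff_compactSpace.1 hS
  let E' : Set S := Subtype.val ⁻¹' E
  let F' : Set S := Subtype.val ⁻¹' F
  have hE' : IsClosed E' := hE.preimage continuous_subtype_val
  have hF' : IsClosed F' := hF.preimage continuous_subtype_val
  have key : ∀ x ∈ E', ∃ Z : Set S, IsClopen Z ∧ x ∈ Z ∧ Disjoint Z F' := by
    intro x hx
    have hcc : connectedComponent x ⊆ F'ᶜ := by
      intro y hy hyF
      refine h (Subtype.val '' connectedComponent x) (by rintro _ ⟨s, _, rfl⟩; exact s.2)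
        (isPreconnected_connectedComponent.image _ continuous_subtype_val.continuousOn)
        ⟨x, ⟨x, mem_connectedComponent, rfl⟩, hx⟩ ⟨y, ⟨y, hy, rfl⟩, hyF⟩
    rw [connectedComponent_eq_iInter_isClopen] at hcc
    haveI : Nonempty { s : Set S // IsClopen s ∧ x ∈ s } := ⟨⟨univ, isClopen_univ, mem_univ x⟩⟩
    have := exists_subset_nhds_of_compactSpace (X := S)
      (V := fun s : { s : Set S // IsClopen s ∧ x ∈ s } => (s : Set S)) ?_ ?_
      (U := F'ᶜ) ?_
    · obtain ⟨⟨Z, hZ, hxZ⟩, hZF⟩ := this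
      exact ⟨Z, hZ, hxZ, disjoint_left.2 fun a ha hb => hZF ha hb⟩
    · rintro ⟨a, ha, ha'⟩ ⟨b, hb, hb'⟩
      exact ⟨⟨a ∩ b, ha.inter hb, ha', hb'⟩, inter_subset_left, inter_subset_right⟩
    · rintro ⟨a, ha, ha'⟩; exact ha.1
    · intro y hy; exact hF'.isOpen_compl.mem_nhds (hcc hy)
  choose! Z hZ1 hZ2 hZ3 using key
  obtain ⟨t, ht, htc⟩ := hE'.isCompact.elim_nhds_subcover Z
    (fun x hx => (hZ1 x hx).2.mem_nhds (hZ2 x hx))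
  let W : Set S := ⋃ x ∈ t, Z x
  have hW : IsClopen W := isClopen_biUnion_finset fun x hx => hZ1 x (ht x hx)
  refine ⟨Subtype.val '' W, Subtype.val '' Wᶜ, ?_, ?_, ?_, ?_, ?_, ?_⟩
  · exact (hW.1.isCompact.image continuous_subtype_val).isClosed
  · exact (hW.compl.1.isCompact.image continuous_subtype_val).isClosed
  · exact (disjoint_image_iff Subtype.val_injective).2 disjoint_compl_right
  · rw [← image_union, union_compl_self, image_univ, Subtype.range_coe]
  · intro x hx; exact ⟨⟨x, hES hx⟩, htc hx, rfl⟩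
  · rw [disjoint_left]
    rintro _ ⟨s, hs, rfl⟩ hsF
    simp only [W, mem_iUnion] at hs
    obtain ⟨x, hx, hs⟩ := hs
    exact disjoint_left.1 (hZ3 x (ht x hx)) hs hsF

lemma aux_bump {X : Set α} (hX : IsContinuum X) {f : α → ℝ} (hf : Continuous f) {x y : α} {r : ℝ}
    (hx : x ∈ X) (hy : y ∈ X) (hxr : f x ≤ r) (hyr : r ≤ f y) :
    ∃ A ⊆ X, IsContinuum A ∧ x ∈ A ∧ (∀ a ∈ A, f a ≤ r) ∧ ∃ a ∈ A, f a = r := by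
  obtain ⟨hXc, hXn⟩ := hX
  let S := X ∩ {a | f a ≤ r}
  let F := X ∩ {a | f a = r}
  have hS : IsCompact S := hXc.inter_right (isClosed_le hf continuous_const)
  have hF : IsClosed F := hXc.isClosed.inter (isClosed_eq hf continuous_const)
  by_cases h : ∀ C ⊆ S, IsPreconnected C → (C ∩ {x}).Nonempty → (C ∩ F).Nonempty → False
  · exfalso
    obtain ⟨C1, C2, h1, h2, h12, hu, hE1, hF1⟩ := aux_sep hS isClosed_singleton hF
      (by rintro _ rfl; exact ⟨hx, hxr⟩) h
    have hC1 : ∀ a ∈ C1, f a < r := by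
      intro a ha
      have haS : a ∈ S := hu ▸ Or.inl ha
      refine lt_of_le_of_ne haS.2 fun hh => disjoint_left.1 hF1 ha ⟨haS.1, hh⟩
    have := isPreconnected_closed_iff.1 hXn.2 C1 (C2 ∪ (X ∩ {a | r ≤ f a})) h1
      (h2.union (hXc.isClosed.inter (isClosed_le continuous_const hf))) ?_ ?_ ?_
    · obtain ⟨a, ha, ha1, ha2 | ha2⟩ := this
      · exact disjoint_left.1 h12 ha1 ha2
      · exact absurd (hC1 a ha1) (not_lt.2 ha2.2)
    · intro a ha
      rcases le_total (f a) r with h | h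
      · have : a ∈ C1 ∪ C2 := hu ▸ (⟨ha, h⟩ : a ∈ S)
        rcases this with h | h
        · exact Or.inl h
        · exact Or.inr (Or.inl h)
      · exact Or.inr (Or.inr ⟨ha, h⟩)
    · exact ⟨x, hx, hE1 rfl⟩
    · exact ⟨y, hy, Or.inr ⟨hy, hyr⟩⟩
  · push Not at h
    obtain ⟨C, hCS, hC, ⟨x', hx', hx''⟩, ⟨b, hb, hbF⟩, -⟩ := h
    rw [mem_singleton_iff] at hx''; subst hx''
    have hcl : closure C ⊆ S := closure_minimal hCS hS.isClosed
    exact ⟨closure C, fun a ha => (hcl ha).1, ⟨hS.of_isClosed_subset isClosed_closure hcl,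
      ⟨x', subset_closure hx'⟩, hC.closure⟩, subset_closure hx', fun a ha => (hcl ha).2,
      b, subset_closure hb, hbF.2⟩

lemma aux_strip {X : Set α} (hX : IsContinuum X) {f : α → ℝ} (hf : Continuous f) {x y : α}
    {a b : ℝ} (hab : a ≤ b) (hx : x ∈ X) (hy : y ∈ X) (hxa : f x ≤ a) (hyb : b ≤ f y) :
    ∃ A ⊆ X, IsContinuum A ∧ (∀ p ∈ A, a ≤ f p ∧ f p ≤ b) ∧ (∃ p ∈ A, f p = a) ∧
      ∃ p ∈ A, f p = b := by
  obtain ⟨A, hAX, hA, hxA, hAb, q, hq, hqb⟩ := aux_bump hX hf hx hy (hxa.trans hab) hyb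
  obtain ⟨B, hBA, hB, hqB, hBa, p, hp, hpa⟩ := aux_bump hA hf.neg hq hxA (r := -a)
    (by simp; linarith) (by simp; linarith)
  refine ⟨B, hBA.trans hAX, hB, fun s hs => ⟨?_, hAb s (hBA hs)⟩, ⟨p, hp, ?_⟩, q, hqB, hqb⟩
  · have := hBa s hs; simp at this; linarith
  · simp at hpa; linarith

variable {ι : Type*}

/-- Ultralimit of a family of sets. -/
def limset (V : Ultrafilter ι) (X : ι → Set α) : Set α :=
  {x | ∃ p : ι → α, (∀ i, p i ∈ X i) ∧ Tendsto p V (𝓝 x)}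

lemma mem_limset_iff {V : Ultrafilter ι} {X : ι → Set α} (hX : ∀ i, IsCompact (X i))
    (hn : ∀ i, (X i).Nonempty) (x : α) :
    x ∈ limset V X ↔ ∀ ε > 0, ∀ᶠ i in V, (X i ∩ ball x ε).Nonempty := by
  constructor
  · rintro ⟨p, hp, hpt⟩ ε hε
    filter_upwards [hpt (ball_mem_nhds x hε)] with i hi
    exact ⟨p i, hp i, hi⟩
  · intro h
    have : ∀ i, ∃ p ∈ X i, infDist x (X i) = dist x p := fun i =>
      (hX i).exists_infDist_eq_dist (hn i) x
    choose p hp hpd using this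
    refine ⟨p, hp, Metric.tendsto_nhds.2 fun ε hε => ?_⟩
    filter_upwards [h ε hε] with i hi
    obtain ⟨q, hq, hqb⟩ := hi
    rw [dist_comm, ← hpd]
    exact (infDist_le_dist_of_mem hq).trans_lt (by rw [dist_comm]; exact hqb)

lemma limset_isClosed {V : Ultrafilter ι} {X : ι → Set α} (hX : ∀ i, IsCompact (X i))
    (hn : ∀ i, (X i).Nonempty) : IsClosed (limset V X) := by
  rw [← closure_subset_iff_isClosed]
  intro x hx
  rw [mem_limset_iff hX hn]
  intro ε hε
  obtain ⟨y, hy, hxy⟩ := Metric.mem_closure_iff.1 hx (ε/2) (by linarith)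
  filter_upwards [(mem_limset_iff hX hn y).1 hy (ε/2) (by linarith)] with i hi
  obtain ⟨q, hq, hqb⟩ := hi
  refine ⟨q, hq, ?_⟩
  rw [mem_ball] at *
  rw [dist_comm] at hxy
  linarith [dist_triangle q y x]

lemma limset_subset {V : Ultrafilter ι} {X : ι → Set α} {B : Set α} (hB : IsClosed B)
    (hXB : ∀ i, X i ⊆ B) : limset V X ⊆ B := by
  rintro x ⟨p, hp, hpt⟩
  exact hB.mem_of_tendsto hpt (Eventually.of_forall fun i => hXB i (hp i))

lemma exists_lim {V : Ultrafilter ι} {X : ι → Set α} {B : Set α} (hB : IsCompact B)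
    (hXB : ∀ i, X i ⊆ B) (p : ι → α) (hp : ∀ i, p i ∈ X i) :
    ∃ x ∈ limset V X, Tendsto p V (𝓝 x) := by
  obtain ⟨x, hx, hxl⟩ := hB.ultrafilter_le_nhds (V.map p) (by
    rw [le_principal_iff]
    exact (Eventually.of_forall fun i => hXB i (hp i) : ∀ᶠ i in (V : Filter ι), p i ∈ B))
  exact ⟨x, ⟨p, hp, hxl⟩, hxl⟩

lemma limset_nhds {V : Ultrafilter ι} {X : ι → Set α} {B : Set α} (hB : IsCompact B)
    (hXB : ∀ i, X i ⊆ B) (hn : ∀ i, (X i).Nonempty) {N : Set α} (hN : IsOpen N)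
    (h : limset V X ⊆ N) : ∀ᶠ i in V, X i ⊆ N := by
  by_contra hcon
  rw [← Ultrafilter.eventually_not] at hcon
  have : ∀ i, ∃ p ∈ X i, ¬ X i ⊆ N → p ∉ N := by
    intro i
    by_cases h : X i ⊆ N
    · exact ⟨(hn i).some, (hn i).some_mem, fun h' => absurd h h'⟩
    · obtain ⟨p, hp, hpn⟩ := not_subset.1 h
      exact ⟨p, hp, fun _ => hpn⟩
  choose p hp hpn using this
  obtain ⟨x, hx, hxt⟩ := exists_lim (V := V) hB hXB p hp
  have := hN.isClosed_compl.mem_of_tendsto hxt (by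
    filter_upwards [hcon] with i hi using hpn i hi)
  exact this (h hx)

lemma limset_continuum {V : Ultrafilter ι} {X : ι → Set α} {B : Set α} (hB : IsCompact B)
    (hXB : ∀ i, X i ⊆ B) (hX : ∀ i, IsContinuum (X i)) : IsContinuum (limset V X) := by
  have hn : ∀ i, (X i).Nonempty := fun i => (hX i).2.1
  have hc := limset_isClosed (V := V) (fun i => (hX i).1) hn
  have hcc := hB.of_isClosed_subset hc (limset_subset hB.isClosed hXB)
  refine ⟨hcc, ?_, ?_⟩
  · obtain ⟨x, hx, -⟩ := exists_lim (V := V) hB hXB (fun i => (hn i).some)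
      (fun i => (hn i).some_mem)
    exact ⟨x, hx⟩
  · rw [isPreconnected_closed_iff]
    intro u v hu hv huv ⟨a, ha, hau⟩ ⟨b, hb, hbv⟩
    by_contra hcon
    have hdis : Disjoint (limset V X ∩ u) (limset V X ∩ v) := by
      rw [disjoint_left]; intro z hz hz'
      exact hcon ⟨z, hz.1, hz.2, hz'.2⟩
    obtain ⟨U, W, hU, hW, hUu, hWv, hUW⟩ :=
      SeparatedNhds.of_isCompact_isCompact (hcc.inter_right hu) (hcc.inter_right hv) hdis
    have h1 := limset_nhds (V := V) hB hXB hn (hU.union hW) (fun z hz => by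
      rcases huv hz with h | h
      · exact Or.inl (hUu ⟨hz, h⟩)
      · exact Or.inr (hWv ⟨hz, h⟩))
    obtain ⟨p, hp, hpt⟩ := ha
    obtain ⟨q, hq, hqt⟩ := hb
    have h2 : ∀ᶠ i in (V : Filter ι), p i ∈ U := hpt (hU.mem_nhds (hUu ⟨⟨p, hp, hpt⟩, hau⟩))
    have h3 : ∀ᶠ i in (V : Filter ι), q i ∈ W := hqt (hW.mem_nhds (hWv ⟨⟨q, hq, hqt⟩, hbv⟩))
    obtain ⟨i, h1, h2, h3⟩ := (h1.and (h2.and h3)).exists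
    obtain ⟨z, -, hz⟩ := (hX i).2.2 U W hU hW h1 ⟨p i, hp i, h2⟩ ⟨q i, hq i, h3⟩
    exact disjoint_left.1 hUW hz.1 hz.2

lemma limset_bound {V : Ultrafilter ι} {X : ι → Set α} {β : Type*} [PseudoMetricSpace β]
    {h : α → β} (hh : Continuous h)
    {M : ℝ} (hM : ∀ᶠ i in V, ∀ x ∈ X i, ∀ y ∈ X i, dist (h x) (h y) ≤ M) :
    ∀ x ∈ limset V X, ∀ y ∈ limset V X, dist (h x) (h y) ≤ M := by
  rintro x ⟨p, hp, hpt⟩ y ⟨q, hq, hqt⟩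
  refine le_of_tendsto (((hh.tendsto x).comp hpt).dist ((hh.tendsto y).comp hqt)) ?_
  filter_upwards [hM] with i hi using hi _ (hp i) _ (hq i)

lemma limset_big {V : Ultrafilter ι} {X : ι → Set α} {B : Set α} (hB : IsCompact B)
    (hXB : ∀ i, X i ⊆ B) {δ : ℝ} (h : ∀ i, ∃ x ∈ X i, ∃ y ∈ X i, δ ≤ dist x y) :
    ∃ x ∈ limset V X, ∃ y ∈ limset V X, δ ≤ dist x y := by
  choose p hp q hq hpq using h
  obtain ⟨x, hx, hxt⟩ := exists_lim (V := V) hB hXB p hp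
  obtain ⟨y, hy, hyt⟩ := exists_lim (V := V) hB hXB q hq
  exact ⟨x, hx, y, hy, ge_of_tendsto (hxt.dist hyt) (Eventually.of_forall hpq)⟩

end GenTop

section Cross

lemma aux_barrier_lt {f : ℝ → ℝ} (hf : Continuous f) {c a b : ℝ} (ha : f a < c)
    (h : ∀ t, f t ≠ c) : f b < c := by
  by_contra hb
  push Not at hb
  obtain ⟨t, ht⟩ := mem_range_of_exists_le_of_exists_ge hf ⟨a, ha.le⟩ ⟨b, hb⟩
  exact h t ht

lemma aux_barrier_gt {f : ℝ → ℝ} (hf : Continuous f) {c a b : ℝ} (ha : c < f a)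
    (h : ∀ t, f t ≠ c) : c < f b := by
  by_contra hb
  push Not at hb
  obtain ⟨t, ht⟩ := mem_range_of_exists_le_of_exists_ge hf ⟨b, hb⟩ ⟨a, ha.le⟩
  exact h t ht

lemma aux_miranda (F : ℝ × ℝ → ℂ) (hF : Continuous F)
    (h0 : ∀ t, (F (0, t)).im < 0) (h1 : ∀ t, 0 < (F (1, t)).im)
    (h2 : ∀ s, 0 < (F (s, 0)).re) (h3 : ∀ s, (F (s, 1)).re < 0) : ∃ x, F x = 0 := by
  by_contra hcon
  push Not at hcon
  obtain ⟨L, ⟨hL0, hL⟩, -⟩ := Complex.isCoveringMapOn_exp.existsUnique_continuousMap_lifts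
    (⟨F, hF⟩ : C(ℝ × ℝ, ℂ)) (a₀ := (0, 0)) (e₀ := Complex.log (F (0, 0)))
    (by simp [Complex.exp_log (hcon _)]) (fun a => by simpa using hcon a)
  have hLe : ∀ a, Complex.exp (L a) = F a := fun a => congrFun hL a
  have hre : ∀ a, (F a).re = Real.exp (L a).re * Real.cos (L a).im := fun a => by
    rw [← hLe, Complex.exp_re]
  have him : ∀ a, (F a).im = Real.exp (L a).re * Real.sin (L a).im := fun a => by
    rw [← hLe, Complex.exp_im]
  have pe : ∀ a, 0 < Real.exp (L a).re := fun a => Real.exp_pos _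
  have hs0 : ∀ t, Real.sin (L (0, t)).im < 0 := fun t => by
    have := h0 t; rw [him] at this; by_contra hc; push Not at hc
    have := mul_nonneg (pe (0, t)).le hc; linarith
  have hs1 : ∀ t, 0 < Real.sin (L (1, t)).im := fun t => by
    have := h1 t; rw [him] at this; exact (mul_pos_iff_of_pos_left (pe _)).1 this
  have hc0 : ∀ s, 0 < Real.cos (L (s, 0)).im := fun t => by
    have := h2 t; rw [hre] at this; exact (mul_pos_iff_of_pos_left (pe _)).1 this
  have hc1 : ∀ s, Real.cos (L (s, 1)).im < 0 := fun t => by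
    have := h3 t; rw [hre] at this; by_contra hc; push Not at hc
    have := mul_nonneg (pe (t, 1)).le hc; linarith
  have hpi := Real.pi_pos
  have e00 : (L (0, 0)).im < 0 ∧ -(Real.pi / 2) < (L (0, 0)).im := by
    rw [hL0, Complex.log_im]
    constructor
    · exact Complex.arg_neg_iff.2 (h0 0)
    · exact (abs_lt.1 (Complex.abs_arg_lt_pi_div_two_iff.2 (Or.inl (h2 0)))).1
  have cont1 : Continuous fun s : ℝ => (L (s, 0)).im := by fun_prop
  have cont2 : Continuous fun s : ℝ => (L (s, 1)).im := by fun_prop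
  have cont3 : Continuous fun s : ℝ => (L (0, s)).im := by fun_prop
  have cont4 : Continuous fun s : ℝ => (L (1, s)).im := by fun_prop
  have e10 : 0 < (L (1, 0)).im ∧ (L (1, 0)).im < Real.pi := by
    have a1 : (L (1, 0)).im < Real.pi / 2 := by
      refine aux_barrier_lt cont1 (a := 0) (by linarith) fun t ht => ?_
      have := hc0 t; rw [ht] at this; simp at this
    have a2 : -(Real.pi / 2) < (L (1, 0)).im := by
      refine aux_barrier_gt cont1 (a := 0) (by linarith) fun t ht => ?_
      have := hc0 t; rw [ht] at this; simp at this
    refine ⟨?_, by linarith⟩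
    by_contra hc
    push Not at hc
    have := Real.sin_nonpos_of_nonpos_of_neg_pi_le hc (by linarith)
    linarith [hs1 0]
  have e11 : 0 < (L (1, 1)).im := by
    refine aux_barrier_gt cont4 (a := 0) e10.1 fun t ht => ?_
    have := hs1 t; rw [ht] at this; simp at this
  have e01 : (L (0, 1)).im < 0 := by
    refine aux_barrier_lt cont3 (a := 0) e00.1 fun t ht => ?_
    have := hs0 t; rw [ht] at this; simp at this
  have : (L (1, 1)).im < 0 := by
    refine aux_barrier_lt cont2 (a := 0) e01 fun t ht => ?_
    have := hc1 t; rw [ht] at this; simp at this; linarith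
  linarith

lemma aux_thick_conn {V : Set R2} (hV : IsConnected V) {ε : ℝ} (hε : 0 < ε) :
    IsPathConnected (thickening ε V) := by
  rw [← IsOpen.isConnected_iff_isPathConnected isOpen_thickening]
  obtain ⟨x, hx⟩ := hV.1
  refine ⟨⟨x, self_subset_thickening hε V hx⟩, ?_⟩
  refine isPreconnected_of_forall x fun y hy => ?_
  obtain ⟨v, hv, hyv⟩ := mem_thickening_iff.1 hy
  refine ⟨V ∪ ball v ε, union_subset (self_subset_thickening hε V) (ball_subset_thickening hv ε),
    Or.inl hx, Or.inr hyv, ?_⟩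
  exact IsPreconnected.union v hv (mem_ball_self hε) hV.2 (convex_ball v ε).isPreconnected

/-- A vertical continuum in a strip and a horizontal one cross. -/
lemma aux_cross {V H : Set R2} (hV : IsContinuum V) (hH : IsContinuum H) {a b c e : ℝ}
    (hVs : ∀ p ∈ V, a ≤ p.1 ∧ p.1 ≤ b) (hHs : ∀ p ∈ H, c ≤ p.2 ∧ p.2 ≤ e)
    (v0 : ∃ p ∈ V, p.2 < c) (v1 : ∃ p ∈ V, e < p.2)
    (w0 : ∃ p ∈ H, p.1 < a) (w1 : ∃ p ∈ H, b < p.1) : (V ∩ H).Nonempty := by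
  by_contra hcon
  have hdis : Disjoint V H := by
    rw [disjoint_iff_inter_eq_empty]; exact not_nonempty_iff_eq_empty.1 hcon
  obtain ⟨δ, hδ, hdis⟩ := hdis.exists_thickenings hV.1 hH.1.isClosed
  obtain ⟨p0, hp0, hp0'⟩ := v0
  obtain ⟨p1, hp1, hp1'⟩ := v1
  obtain ⟨q0, hq0, hq0'⟩ := w0
  obtain ⟨q1, hq1, hq1'⟩ := w1
  obtain ⟨ε, hε, hεδ, e1, e2, e3, e4⟩ : ∃ ε > 0, ε ≤ δ ∧ ε ≤ c - p0.2 ∧ ε ≤ p1.2 - e ∧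
      ε ≤ a - q0.1 ∧ ε ≤ q1.1 - b := by
    refine ⟨min δ (min (min (c - p0.2) (p1.2 - e)) (min (a - q0.1) (q1.1 - b))), ?_, ?_⟩
    · simp only [gt_iff_lt, lt_min_iff]; refine ⟨hδ, ⟨?_, ?_⟩, ?_, ?_⟩ <;> linarith
    · simp
  have hdis' : Disjoint (thickening ε V) (thickening ε H) :=
    hdis.mono (thickening_mono hεδ _) (thickening_mono hεδ _)
  obtain ⟨p, hp⟩ := (aux_thick_conn hV.2 hε).joinedIn p0 (self_subset_thickening hε _ hp0) p1
    (self_subset_thickening hε _ hp1)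
  obtain ⟨q, hq⟩ := (aux_thick_conn hH.2 hε).joinedIn q0 (self_subset_thickening hε _ hq0) q1
    (self_subset_thickening hε _ hq1)
  have hpe : ∀ s, p.extend s ∈ thickening ε V := fun s => by
    have : p.extend s ∈ range p.extend := ⟨s, rfl⟩
    rw [Path.extend_range] at this
    obtain ⟨t, ht⟩ := this
    rw [← ht]; exact hp t
  have hqe : ∀ s, q.extend s ∈ thickening ε H := fun s => by
    have : q.extend s ∈ range q.extend := ⟨s, rfl⟩
    rw [Path.extend_range] at this
    obtain ⟨t, ht⟩ := this
    rw [← ht]; exact hq t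
  have hpb : ∀ s, a - ε < (p.extend s).1 ∧ (p.extend s).1 < b + ε := fun s => by
    obtain ⟨v, hv, hd⟩ := mem_thickening_iff.1 (hpe s)
    have h1 : dist (p.extend s).1 v.1 < ε := lt_of_le_of_lt (le_max_left _ _) hd
    rw [Real.dist_eq, abs_lt] at h1
    constructor <;> linarith [hVs v hv]
  have hqb : ∀ s, c - ε < (q.extend s).2 ∧ (q.extend s).2 < e + ε := fun s => by
    obtain ⟨v, hv, hd⟩ := mem_thickening_iff.1 (hqe s)
    have h1 : dist (q.extend s).2 v.2 < ε := lt_of_le_of_lt (le_max_right _ _) hd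
    rw [Real.dist_eq, abs_lt] at h1
    constructor <;> linarith [hHs v hv]
  have cp : Continuous p.extend := p.continuous_extend
  have cq : Continuous q.extend := q.continuous_extend
  obtain ⟨⟨s, t⟩, hst⟩ := aux_miranda (fun x => ⟨(p.extend x.1).1 - (q.extend x.2).1,
      (p.extend x.1).2 - (q.extend x.2).2⟩)
      (by
        have : Continuous fun x : ℝ × ℝ => Complex.equivRealProdCLM.symm
          ((p.extend x.1).1 - (q.extend x.2).1, (p.extend x.1).2 - (q.extend x.2).2) :=
          Complex.equivRealProdCLM.symm.continuous.comp (by fun_prop)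
        convert this using 2
        apply Complex.ext <;> simp)
      (fun t => by simp; linarith [hqb t]) (fun t => by simp; linarith [hqb t])
      (fun t => by simp; linarith [hpb t]) (fun t => by simp; linarith [hpb t])
  · have h1 := congrArg Complex.re hst
    have h2 := congrArg Complex.im hst
    simp only [Complex.zero_re, Complex.zero_im] at h1 h2
    have : p.extend s = q.extend t := Prod.ext (by linarith) (by linarith)
    exact disjoint_left.1 hdis' (hpe s) (this ▸ hqe t)

end Cross

section Dyn

/-- Integer vector. -/
def zv (v : ℤ × ℤ) : R2 := ((v.1 : ℝ), (v.2 : ℝ))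

/-- Commutation with the integer translations. -/
def Equi (G : R2 ≃ₜ R2) : Prop := ∀ x v, G (x + zv v) = G x + zv v

/-- Forward boundedness. -/
def FB (G : R2 ≃ₜ R2) (M : ℝ) (X : Set R2) : Prop :=
  ∀ j : ℕ, ∀ x ∈ X, ∀ y ∈ X, dist (G^[j] x) (G^[j] y) ≤ M

/-- The expansivity property used. -/
def Expa (G : R2 ≃ₜ R2) : Prop :=
  ∀ K : Set R2, IsContinuum K → ∀ M, FB G M K → FB G.symm M K → K.Subsingleton

/-- Integer part. -/
def fl (x : R2) : ℤ × ℤ := (⌊x.1⌋, ⌊x.2⌋)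

lemma fl_norm (x : R2) : ‖x - zv (fl x)‖ ≤ 1 := by
  rw [Prod.norm_def]
  simp only [zv, fl, Prod.fst_sub, Prod.snd_sub, Real.norm_eq_abs]
  refine max_le ?_ ?_ <;> rw [abs_le] <;> constructor <;>
    linarith [Int.floor_le x.1, Int.lt_floor_add_one x.1, Int.floor_le x.2,
      Int.lt_floor_add_one x.2]

lemma Equi.symm {G : R2 ≃ₜ R2} (h : Equi G) : Equi G.symm := by
  intro x v
  rw [Homeomorph.symm_apply_eq, h, Homeomorph.apply_symm_apply]

lemma Expa.symm {G : R2 ≃ₜ R2} (h : Expa G) : Expa G.symm :=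
  fun K hK M h1 h2 => h K hK M h2 h1

lemma Equi.iter {G : R2 ≃ₜ R2} (h : Equi G) (j : ℕ) (x : R2) (v : ℤ × ℤ) :
    G^[j] (x + zv v) = G^[j] x + zv v := by
  induction j generalizing x with
  | zero => rfl
  | succ n ih => rw [Function.iterate_succ_apply, h, ih, Function.iterate_succ_apply]

lemma Equi.iter_sub {G : R2 ≃ₜ R2} (h : Equi G) (j : ℕ) (x : R2) (v : ℤ × ℤ) :
    G^[j] (x - zv v) = G^[j] x - zv v := by
  have := h.iter j (x - zv v) v
  rw [sub_add_cancel] at this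
  rw [this, add_sub_cancel_right]

lemma cont_iter (G : R2 ≃ₜ R2) (j : ℕ) : Continuous (G^[j]) := G.continuous.iterate j

lemma symm_iter (G : R2 ≃ₜ R2) (j : ℕ) (x : R2) : G.symm^[j] (G^[j] x) = x :=
  (Function.LeftInverse.iterate G.symm_apply_apply j) x

lemma iter_symm (G : R2 ≃ₜ R2) (j : ℕ) (x : R2) : G^[j] (G.symm^[j] x) = x :=
  (Function.LeftInverse.iterate G.apply_symm_apply j) x

lemma symm_iter_sub (G : R2 ≃ₜ R2) {i j : ℕ} (h : i ≤ j) (x : R2) :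
    G.symm^[i] (G^[j] x) = G^[j - i] x := by
  obtain ⟨k, rfl⟩ := Nat.exists_eq_add_of_le h
  rw [Function.iterate_add_apply, symm_iter, Nat.add_sub_cancel_left]

lemma IsContinuum.image' {X : Set R2} (h : IsContinuum X) {f : R2 → R2} (hf : Continuous f) :
    IsContinuum (f '' X) := ⟨h.1.image hf, h.2.image f hf.continuousOn⟩

lemma FB.mono {G : R2 ≃ₜ R2} {M M' : ℝ} {X Y : Set R2} (h : FB G M X) (hY : Y ⊆ X) (hM : M ≤ M') :
    FB G M' Y := fun j x hx y hy => (h j x (hY hx) y (hY hy)).trans hM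

lemma FB.translate {G : R2 ≃ₜ R2} (hG : Equi G) {M : ℝ} {X : Set R2} (h : FB G M X) (v : ℤ × ℤ) :
    FB G M ((fun p => p - zv v) '' X) := by
  rintro j _ ⟨x, hx, rfl⟩ _ ⟨y, hy, rfl⟩
  simp only [hG.iter_sub, dist_sub_right]
  exact h j x hx y hy

lemma hyper_ge (j : ℕ) : ∀ᶠ n in (hyperfilter ℕ : Filter ℕ), j ≤ n := by
  have : (hyperfilter ℕ : Filter ℕ) ≤ atTop := by
    rw [← Nat.cofinite_eq_atTop]; exact hyperfilter_le_cofinite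
  exact this (eventually_ge_atTop j)

lemma lemN {G : R2 ≃ₜ R2} (hG : Equi G) (hE : Expa G) {ε : ℝ} (hε : 0 < ε) (M : ℝ) :
    ∃ N : ℕ, ∀ X, IsContinuum X → (∀ j ≤ N, ∀ x ∈ X, ∀ y ∈ X,
      dist (G^[j] x) (G^[j] y) ≤ M ∧ dist (G.symm^[j] x) (G.symm^[j] y) ≤ M) →
      ∀ x ∈ X, ∀ y ∈ X, dist x y < ε := by
  by_contra hcon
  push Not at hcon
  choose X hX hb x hx y hy hxy using hcon
  let Y : ℕ → Set R2 := fun n => (fun p => p - zv (fl (x n))) '' X n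
  have hY : ∀ n, IsContinuum (Y n) := fun n => (hX n).image' (by fun_prop)
  have hYB : ∀ n, Y n ⊆ closedBall 0 (1 + M) := by
    rintro n _ ⟨p, hp, rfl⟩
    have h1 := (hb n 0 (Nat.zero_le _) p hp (x n) (hx n)).1
    simp only [Function.iterate_zero, id] at h1
    simp only [mem_closedBall, dist_zero_right]
    have : p - zv (fl (x n)) = (x n - zv (fl (x n))) + (p - x n) := by abel
    rw [this]
    refine (norm_add_le _ _).trans (add_le_add (fl_norm _) ?_)
    rwa [← dist_eq_norm]
  have hB : IsCompact (closedBall (0 : R2) (1 + M)) := isCompact_closedBall _ _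
  have hL := limset_continuum (V := hyperfilter ℕ) hB hYB hY
  obtain ⟨a, ha, b, hb', hab⟩ := limset_big (V := hyperfilter ℕ) hB hYB (δ := ε) (fun n =>
    ⟨_, ⟨x n, hx n, rfl⟩, _, ⟨y n, hy n, rfl⟩, by simpa using hxy n⟩)
  have hsub := hE _ hL M ?_ ?_
  · have := hsub ha hb'
    rw [this, dist_self] at hab
    linarith
  · intro j
    refine limset_bound (cont_iter G j) ?_
    filter_upwards [hyper_ge j] with n hn
    rintro _ ⟨x, hx, rfl⟩ _ ⟨y, hy, rfl⟩
    simp only [hG.iter_sub, dist_sub_right]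
    exact (hb n j hn x hx y hy).1
  · intro j
    refine limset_bound (cont_iter G.symm j) ?_
    filter_upwards [hyper_ge j] with n hn
    rintro _ ⟨x, hx, rfl⟩ _ ⟨y, hy, rfl⟩
    simp only [hG.symm.iter_sub, dist_sub_right]
    exact (hb n j hn x hx y hy).2

lemma contract {G : R2 ≃ₜ R2} (hG : Equi G) (hE : Expa G) {X : Set R2} (hX : IsContinuum X) {M : ℝ}
    (hM : FB G M X) {ε : ℝ} (hε : 0 < ε) :
    ∃ J : ℕ, ∀ j ≥ J, ∀ x ∈ X, ∀ y ∈ X, dist (G^[j] x) (G^[j] y) < ε := by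
  obtain ⟨N, hN⟩ := lemN hG hE hε M
  refine ⟨N, fun j hj x hx y hy => hN (G^[j] '' X) (hX.image' (cont_iter G j)) ?_ _ ⟨x, hx, rfl⟩ _
    ⟨y, hy, rfl⟩⟩
  rintro i hi _ ⟨x, hx, rfl⟩ _ ⟨y, hy, rfl⟩
  rw [symm_iter_sub G (hi.trans hj), symm_iter_sub G (hi.trans hj), ← Function.iterate_add_apply,
    ← Function.iterate_add_apply]
  exact ⟨hM _ _ hx _ hy, hM _ _ hx _ hy⟩

/-- Bowen distance. -/
def bow (G : R2 ≃ₜ R2) (n : ℕ) (x y : R2) : ℝ :=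
  (Finset.range (n + 1)).sup' Finset.nonempty_range_add_one fun j => dist (G^[j] y) (G^[j] x)

lemma bow_cont (G : R2 ≃ₜ R2) (n : ℕ) (x : R2) : Continuous (bow G n x) := by
  unfold bow
  refine Continuous.finset_sup'_apply _ fun j _ => ?_
  exact (cont_iter G j).dist continuous_const

lemma bow_le {G : R2 ≃ₜ R2} {n : ℕ} {x y : R2} {r : ℝ} :
    bow G n x y ≤ r ↔ ∀ j ≤ n, dist (G^[j] y) (G^[j] x) ≤ r := by
  unfold bow
  rw [Finset.sup'_le_iff]
  simp [Nat.lt_succ_iff]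

lemma le_bow {G : R2 ≃ₜ R2} {n : ℕ} {x y : R2} {r : ℝ} :
    r ≤ bow G n x y ↔ ∃ j ≤ n, r ≤ dist (G^[j] y) (G^[j] x) := by
  unfold bow
  rw [Finset.le_sup'_iff]
  simp [Nat.lt_succ_iff]

lemma bow_self (G : R2 ≃ₜ R2) (n : ℕ) (x : R2) : bow G n x x ≤ 0 := by
  rw [bow_le]; simp

lemma dist_le_bow (G : R2 ≃ₜ R2) (n : ℕ) (x y : R2) {j : ℕ} (hj : j ≤ n) :
    dist (G^[j] y) (G^[j] x) ≤ bow G n x y := bow_le.1 le_rfl j hj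

end Dyn

section Pieces

lemma unif1 {G : R2 ≃ₜ R2} (hG : Equi G) (j : ℕ) {r : ℝ} (hr : 0 < r) :
    ∃ δ > 0, ∀ x y, dist x y ≤ δ → dist (G^[j] x) (G^[j] y) < r := by
  have := (isCompact_closedBall (0 : R2) 2).uniformContinuousOn_of_continuous
    (cont_iter G j).continuousOn
  obtain ⟨δ, hδ, h⟩ := Metric.uniformContinuousOn_iff.1 this r hr
  refine ⟨min (δ / 2) 1, by positivity, fun x y hxy => ?_⟩
  have h1 := fl_norm x
  have h2 : dist x y ≤ 1 := hxy.trans (min_le_right _ _)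
  have h3 : dist x y < δ := (hxy.trans (min_le_left _ _)).trans_lt (by linarith)
  have := h (x - zv (fl x)) (by simp; linarith) (y - zv (fl x)) ?_ (by simpa using h3)
  · simpa only [hG.iter_sub, dist_sub_right] using this
  · simp only [mem_closedBall, dist_zero_right]
    have : y - zv (fl x) = (x - zv (fl x)) + (y - x) := by abel
    rw [this]
    refine (norm_add_le _ _).trans ?_
    rw [← dist_eq_norm y x, dist_comm y x]
    linarith

lemma unif {G : R2 ≃ₜ R2} (hG : Equi G) (n : ℕ) {r : ℝ} (hr : 0 < r) :
    ∃ δ > 0, ∀ x y, dist x y ≤ δ → ∀ j ≤ n, dist (G^[j] x) (G^[j] y) < r := by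
  induction n with
  | zero =>
    obtain ⟨δ, hδ, h⟩ := unif1 hG 0 hr
    refine ⟨δ, hδ, fun x y hxy j hj => ?_⟩
    obtain rfl : j = 0 := by omega
    exact h x y hxy
  | succ n ih =>
    obtain ⟨δ, hδ, h⟩ := ih
    obtain ⟨δ', hδ', h'⟩ := unif1 hG (n + 1) hr
    refine ⟨min δ δ', lt_min hδ hδ', fun x y hxy j hj => ?_⟩
    rcases Nat.le_succ_iff.1 hj with h1 | rfl
    · exact h x y (hxy.trans (min_le_left _ _)) j h1
    · exact h' x y (hxy.trans (min_le_right _ _))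

lemma lemQ {G : R2 ≃ₜ R2} (hG : Equi G) (hE : Expa G) :
    ∃ δ > 0, ∀ X m, IsContinuum X → FB G m X →
      (∃ x ∈ X, ∃ y ∈ X, ∃ j : ℕ, 1 ≤ dist (G^[j] x) (G^[j] y)) →
      ∃ A ⊆ X, IsContinuum A ∧ FB G 1 A ∧ ∃ a ∈ A, ∃ b ∈ A, δ ≤ dist a b := by
  obtain ⟨N, hN⟩ := lemN hG hE (ε := 1 / 2) (by norm_num) 1
  obtain ⟨δ, hδ, hu⟩ := unif hG N (r := 1 / 2) (by norm_num)
  refine ⟨δ, hδ, ?_⟩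
  rintro X m hX hm ⟨x, hx, y, hy, j0, hj0⟩
  obtain ⟨J, hJ⟩ := contract hG hE hX hm (ε := 1 / 2) (by norm_num)
  obtain ⟨A, hAX, hA, hxA, hAb, a, ha, hab⟩ := aux_bump hX (bow_cont G (max J j0) x) (r := 1 / 2)
    hx hy ((bow_self _ _ _).trans (by norm_num))
    (le_trans (by rw [dist_comm] at hj0; linarith) (dist_le_bow G (max J j0) x y (le_max_right J j0)))
  have hAx : ∀ u ∈ A, ∀ j : ℕ, dist (G^[j] u) (G^[j] x) ≤ 1 / 2 := by
    intro u hu j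
    rcases le_total j J with h | h
    · exact bow_le.1 (hAb u hu) j (h.trans (le_max_left _ _))
    · exact (hJ j h u (hAX hu) x hx).le
  have hFB : FB G 1 A := by
    intro j u hu v hv
    have h1 := hAx u hu j
    have h2 := hAx v hv j
    rw [dist_comm] at h2
    linarith [dist_triangle (G^[j] u) (G^[j] x) (G^[j] v)]
  refine ⟨A, hAX, hA, hFB, a, ha, x, hxA, ?_⟩
  obtain ⟨j1, -, hj1⟩ := le_bow.1 hab.ge
  by_contra hc
  push Not at hc
  rcases le_total j1 N with h | h
  · linarith [hu a x hc.le j1 h]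
  · have := hN (G^[j1] '' A) (hA.image' (cont_iter G j1)) ?_ _ ⟨a, ha, rfl⟩ _ ⟨x, hxA, rfl⟩
    · linarith
    rintro i hi _ ⟨x, hx, rfl⟩ _ ⟨y, hy, rfl⟩
    rw [symm_iter_sub G (hi.trans h), symm_iter_sub G (hi.trans h), ← Function.iterate_add_apply,
      ← Function.iterate_add_apply]
    exact ⟨hFB _ _ hx _ hy, hFB _ _ hx _ hy⟩

lemma stable_bdd {G : R2 ≃ₜ R2} {z u : R2} (hu : u ∈ stableSet G z) :
    ∃ ε : ℝ, ∀ j : ℕ, dist (G^[j] u) (G^[j] z) ≤ ε := by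
  simp only [stableSet, mem_iUnion] at hu
  obtain ⟨ε, _, hu⟩ := hu
  exact ⟨ε, connectedComponentIn_subset _ _ hu⟩

lemma stable_asym {G : R2 ≃ₜ R2} (hG : Equi G) (hE : Expa G) {z u : R2} (hu : u ∈ stableSet G z)
    {ε : ℝ} (hε : 0 < ε) : ∃ J : ℕ, ∀ j ≥ J, dist (G^[j] u) (G^[j] z) < ε := by
  simp only [stableSet, mem_iUnion] at hu
  obtain ⟨m, hm, hu⟩ := hu
  let S : Set R2 := {z' : R2 | ∀ j : ℕ, dist ((⇑G)^[j] z') ((⇑G)^[j] z) ≤ m}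
  have hS : IsClosed S := by
    simp only [S, ofPred_forall]
    exact isClosed_iInter fun j => isClosed_le ((cont_iter G j).dist continuous_const)
      continuous_const
  have hzS : z ∈ S := fun j => by simpa using hm.le
  have hcl : closure (stableComp G m z) ⊆ S :=
    closure_minimal (connectedComponentIn_subset _ _) hS
  have hzC : z ∈ stableComp G m z := mem_connectedComponentIn hzS
  have hcont : IsContinuum (closure (stableComp G m z)) := by
    refine ⟨(isCompact_closedBall z m).of_isClosed_subset isClosed_closure fun x hx => hcl hx 0,
      ⟨z, subset_closure hzC⟩, ?_⟩
    exact isPreconnected_connectedComponentIn.closure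
  have hFB : FB G (m + m) (closure (stableComp G m z)) := by
    intro j x hx y hy
    have h1 := hcl hx j
    have h2 := hcl hy j
    rw [dist_comm] at h2
    linarith [dist_triangle (G^[j] x) (G^[j] z) (G^[j] y)]
  obtain ⟨J, hJ⟩ := contract hG hE hcont hFB hε
  exact ⟨J, fun j hj => hJ j hj u (subset_closure hu) z (subset_closure hzC)⟩

lemma lemP {G : R2 ≃ₜ R2} {z : R2} {X : Set R2} (hX : IsContinuum X) (hXs : X ⊆ stableSet G z)
    (hbig : ∃ x ∈ X, ∃ y ∈ X, 1 ≤ dist x y) :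
    ∃ X' ⊆ X, ∃ m, IsContinuum X' ∧ FB G m X' ∧
      ∃ x ∈ X', ∃ y ∈ X', ∃ j : ℕ, 1 ≤ dist (G^[j] x) (G^[j] y) := by
  by_contra hcon
  push Not at hcon
  have step : ∀ (k : ℕ) (Y : Set R2), (IsContinuum Y ∧ Y ⊆ X ∧ ∀ m, ¬ FB G m Y) →
      ∃ Y' : Set R2, (IsContinuum Y' ∧ Y' ⊆ X ∧ ∀ m, ¬ FB G m Y') ∧ Y' ⊆ Y ∧
        ∃ j : ℕ, ∀ u ∈ Y', (k : ℝ) ≤ dist (G^[j] u) (G^[j] z) := by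
    rintro k Y ⟨hY, hYX, hYF⟩
    have := hYF (2 * (k + 2))
    unfold FB at this
    push Not at this
    obtain ⟨j, y, hy, y', hy', hyy⟩ := this
    obtain ⟨p, hp, hpk⟩ : ∃ p ∈ Y, (k : ℝ) + 2 < dist (G^[j] p) (G^[j] z) := by
      by_contra hc
      push Not at hc
      have h1 := hc y hy
      have h2 := hc y' hy'
      rw [dist_comm] at h2
      linarith [dist_triangle (G^[j] y) (G^[j] z) (G^[j] y')]
    by_cases hall : ∀ u ∈ Y, (k : ℝ) ≤ dist (G^[j] u) (G^[j] z)
    · exact ⟨Y, ⟨hY, hYX, hYF⟩, Subset.rfl, j, hall⟩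
    push Not at hall
    obtain ⟨u, hu, huk⟩ := hall
    obtain ⟨A, hAY, hA, hpA, hAk, a, ha, hak⟩ := aux_bump hY
      (f := fun u => - dist (G^[j] u) (G^[j] z)) (r := -k)
      ((cont_iter G j).dist continuous_const).neg hp hu (by linarith) (by linarith)
    refine ⟨A, ⟨hA, hAY.trans hYX, fun m hm => ?_⟩, hAY, j, fun u hu => by linarith [hAk u hu]⟩
    have := hcon A (hAY.trans hYX) m hA hm p hpA a ha j
    linarith [dist_triangle (G^[j] p) (G^[j] a) (G^[j] z)]
  have hX0 : IsContinuum X ∧ X ⊆ X ∧ ∀ m, ¬ FB G m X := by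
    refine ⟨hX, Subset.rfl, fun m hm => ?_⟩
    obtain ⟨x, hx, y, hy, hxy⟩ := hbig
    have := hcon X Subset.rfl m hX hm x hx y hy 0
    simp at this
    linarith
  choose! Φ hΦ1 hΦ2 hΦ3 using step
  let Y : ℕ → Set R2 := fun n => Nat.rec X (fun k S => Φ k S) n
  have hY : ∀ n, IsContinuum (Y n) ∧ Y n ⊆ X ∧ ∀ m, ¬ FB G m (Y n) := by
    intro n
    induction n with
    | zero => exact hX0
    | succ k ih => exact hΦ1 k _ ih
  obtain ⟨u, hu⟩ := IsCompact.nonempty_iInter_of_sequence_nonempty_isCompact_isClosed Y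
    (fun n => hΦ2 n _ (hY n)) (fun n => (hY n).1.2.1) (hY 0).1.1 (fun n => (hY n).1.1.isClosed)
  rw [mem_iInter] at hu
  obtain ⟨ε, hε⟩ := stable_bdd (hXs ((hY 0).2.1 (hu 0)))
  obtain ⟨k, hk⟩ := exists_nat_gt ε
  obtain ⟨j, hj⟩ := hΦ3 k _ (hY k)
  linarith [hj u (hu (k + 1)), hε j]

end Pieces

section Unst

lemma tendsto_hyper : (hyperfilter ℕ : Filter ℕ) ≤ atTop := by
  rw [← Nat.cofinite_eq_atTop]; exact hyperfilter_le_cofinite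

lemma limH {G : R2 ≃ₜ R2} {r δ : ℝ} {w : R2} (ws : ℕ → R2)
    (hws : Tendsto ws atTop (𝓝 w)) (hw1 : ∀ n, dist (ws n) w ≤ 1)
    (h : ∀ n, ∃ U, IsContinuum U ∧ ws n ∈ U ∧ (∀ u ∈ U, bow G.symm n (ws n) u ≤ r) ∧
      ∃ u ∈ U, δ ≤ dist u (ws n)) :
    ∃ U, IsContinuum U ∧ w ∈ U ∧ (∀ u ∈ U, ∀ i : ℕ, dist (G.symm^[i] u) (G.symm^[i] w) ≤ r) ∧
      ∃ u ∈ U, δ ≤ dist u w := by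
  choose U hU hwU hb u hu hud using h
  have hws' : Tendsto ws (hyperfilter ℕ : Filter ℕ) (𝓝 w) := hws.mono_left tendsto_hyper
  have hB := isCompact_closedBall w (r + 1)
  have hUB : ∀ n, U n ⊆ closedBall w (r + 1) := by
    intro n x hx
    have := bow_le.1 (hb n x hx) 0 (Nat.zero_le _)
    simp only [Function.iterate_zero, id] at this
    rw [mem_closedBall]
    linarith [dist_triangle x (ws n) w, hw1 n]
  refine ⟨limset (hyperfilter ℕ) U, limset_continuum hB hUB hU, ⟨ws, hwU, hws'⟩, ?_, ?_⟩
  · rintro x ⟨p, hp, hpt⟩ i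
    refine le_of_tendsto ((((cont_iter G.symm i).tendsto x).comp hpt).dist
      (((cont_iter G.symm i).tendsto w).comp hws')) ?_
    filter_upwards [hyper_ge i] with n hn
    exact bow_le.1 (hb n _ (hp n)) i hn
  · obtain ⟨x, hx, hxt⟩ := exists_lim (V := hyperfilter ℕ) hB hUB u hu
    exact ⟨x, hx, ge_of_tendsto (hxt.dist hws') (Eventually.of_forall hud)⟩

lemma bad_eq {G : R2 ≃ₜ R2} (hG : Equi G) (hE : Expa G) {r δ : ℝ} (hδ : 0 < δ)
    {a b La Lb : R2} (hLL : dist La Lb ≤ δ / 4) (hab : dist a b < 1 / 2)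
    (hLa : Tendsto (fun n => G.symm^[n] a - zv (fl (G.symm^[n] a))) (hyperfilter ℕ : Filter ℕ) (𝓝 La))
    (hLb : Tendsto (fun n => G.symm^[n] b - zv (fl (G.symm^[n] b))) (hyperfilter ℕ : Filter ℕ) (𝓝 Lb))
    (ha : ∃ n0, ∀ n ≥ n0, ∀ y, dist y (G.symm^[n] a) ≤ δ → ∀ j ≤ n,
      dist (G^[j] y) (G^[j] (G.symm^[n] a)) ≤ r) : a = b := by
  obtain ⟨n0, ha⟩ := ha
  have hB : IsContinuum (closedBall La (δ / 2)) :=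
    ⟨isCompact_closedBall _ _, ⟨La, mem_closedBall_self (by linarith)⟩,
      (convex_closedBall La (δ / 2)).isPreconnected⟩
  have hFB : FB G (r + r) (closedBall La (δ / 2)) := by
    intro j x hx y hy
    have h1 := Metric.tendsto_nhds.1 hLa (δ / 2) (by linarith)
    obtain ⟨n, h1, h2, h3⟩ := (h1.and ((hyper_ge n0).and (hyper_ge j))).exists
    set v := fl (G.symm^[n] a)
    have key : ∀ x ∈ closedBall La (δ / 2),
        dist (G^[j] x) (G^[j] (G.symm^[n] a - zv v)) ≤ r := by
      intro x hx
      have := ha n h2 (x + zv v) (by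
        have : dist (x + zv v) (G.symm^[n] a) = dist x (G.symm^[n] a - zv v) := by
          rw [← dist_sub_right _ _ (zv v), add_sub_cancel_right]
        rw [this]
        rw [mem_closedBall] at hx
        rw [dist_comm] at h1
        linarith [dist_triangle x La (G.symm^[n] a - zv v)]) j h3
      rw [hG.iter_sub]
      rw [hG.iter] at this
      rwa [← dist_sub_right _ _ (zv v), add_sub_cancel_right] at this
    have k1 := key x hx
    have k2 := key y hy
    rw [dist_comm] at k2
    linarith [dist_triangle (G^[j] x) (G^[j] (G.symm^[n] a - zv v)) (G^[j] y)]
  by_contra hne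
  have hpos : 0 < dist a b := dist_pos.2 hne
  obtain ⟨J, hJ⟩ := contract hG hE hB hFB (ε := min (dist a b) (1 / 4)) (by positivity)
  have h1 := Metric.tendsto_nhds.1 hLa (δ / 2) (by linarith)
  have h2 := Metric.tendsto_nhds.1 hLb (δ / 4) (by linarith)
  obtain ⟨n, h1, h2, h3⟩ := (h1.and (h2.and (hyper_ge J))).exists
  have := hJ n h3 _ (mem_closedBall.2 h1.le) (G.symm^[n] b - zv (fl (G.symm^[n] b))) (by
    rw [mem_closedBall]
    rw [dist_comm] at hLL
    linarith [dist_triangle (G.symm^[n] b - zv (fl (G.symm^[n] b))) Lb La])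
  rw [hG.iter_sub, hG.iter_sub, iter_symm, iter_symm, lt_min_iff] at this
  obtain ⟨t1, t2⟩ := this
  set v := fl (G.symm^[n] a)
  set v' := fl (G.symm^[n] b)
  have hv : v = v' := by
    rw [Prod.dist_eq, max_lt_iff, Real.dist_eq, Real.dist_eq, abs_lt, abs_lt] at hab t2
    simp only [zv, Prod.fst_sub, Prod.snd_sub] at t2
    have e1 : ((v.1 : ℝ) - v'.1) < 1 ∧ ((v'.1 : ℝ) - v.1) < 1 := by constructor <;> linarith
    have e2 : ((v.2 : ℝ) - v'.2) < 1 ∧ ((v'.2 : ℝ) - v.2) < 1 := by constructor <;> linarith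
    norm_cast at e1 e2
    refine Prod.ext ?_ ?_ <;> omega
  rw [hv, dist_sub_right] at t1
  exact lt_irrefl _ t1

lemma bad_prop {G : R2 ≃ₜ R2} {r δ δ' : ℝ} (hr : 0 < r) (hδ : 0 < δ) {N : ℕ}
    (hN : ∀ X, IsContinuum X → (∀ j ≤ N, ∀ x ∈ X, ∀ y ∈ X,
      dist (G^[j] x) (G^[j] y) ≤ r + r ∧ dist (G.symm^[j] x) (G.symm^[j] y) ≤ r + r) →
      ∀ x ∈ X, ∀ y ∈ X, dist x y < r)
    (hδ1 : ∀ x y, dist x y ≤ δ → ∀ j ≤ N, dist (G.symm^[j] x) (G.symm^[j] y) < r)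
    (hδ2 : ∀ x y, dist x y ≤ δ' → ∀ j ≤ N, dist (G^[j] x) (G^[j] y) < r)
    {w : R2} {n0 : ℕ} (hbad : ∀ U, IsContinuum U → w ∈ U → (∀ u ∈ U, bow G.symm n0 w u ≤ r) →
      ∀ u ∈ U, dist u w < δ') :
    ∀ n ≥ n0, ∀ y, dist y (G.symm^[n] w) ≤ δ → ∀ j ≤ n,
      dist (G^[j] y) (G^[j] (G.symm^[n] w)) ≤ r := by
  intro n hn y hy
  rw [← bow_le]
  by_contra hc
  push Not at hc
  set x := G.symm^[n] w
  have hB : IsContinuum (closedBall x δ) :=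
    ⟨isCompact_closedBall _ _, ⟨x, mem_closedBall_self hδ.le⟩,
      (convex_closedBall x δ).isPreconnected⟩
  obtain ⟨A, hAB, hA, hxA, hAr, a, ha, har⟩ := aux_bump hB (bow_cont G n x) (r := r)
    (mem_closedBall_self hδ.le) (mem_closedBall.2 hy) ((bow_self _ _ _).trans hr.le) hc.le
  obtain ⟨j1, hj1, hj1r⟩ := le_bow.1 har.ge
  have hwx : G^[n] x = w := iter_symm G n w
  have hU := hbad (G^[n] '' A) (hA.image' (cont_iter G n)) ⟨x, hxA, hwx⟩ (by
    rintro _ ⟨u, hu, rfl⟩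
    rw [bow_le]
    intro i hi
    rw [symm_iter_sub G (hi.trans hn), ← hwx, symm_iter_sub G (hi.trans hn)]
    exact bow_le.1 (hAr u hu) _ (Nat.sub_le _ _))
  have fwd : ∀ i ≤ N, ∀ u ∈ A, dist (G^[i + j1] u) (G^[i + j1] x) ≤ r := by
    intro i hi u hu
    rcases le_total (i + j1) n with h | h
    · exact bow_le.1 (hAr u hu) _ h
    · have h1 := (hU _ ⟨u, hu, rfl⟩).le
      have h2 := hδ2 _ _ h1 (i + j1 - n) (by omega)
      rw [← hwx, ← Function.iterate_add_apply, ← Function.iterate_add_apply,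
        Nat.sub_add_cancel h] at h2
      exact h2.le
  have bwd : ∀ i ≤ N, ∀ u ∈ A, dist (G.symm^[i] (G^[j1] u)) (G.symm^[i] (G^[j1] x)) ≤ r := by
    intro i hi u hu
    rcases le_total i j1 with h | h
    · rw [symm_iter_sub G h, symm_iter_sub G h]
      exact bow_le.1 (hAr u hu) _ (by omega)
    · obtain ⟨k, rfl⟩ := Nat.exists_eq_add_of_le' h
      rw [Function.iterate_add_apply, Function.iterate_add_apply, symm_iter, symm_iter]
      exact (hδ1 _ _ (hAB hu) k (by omega)).le
  have := hN (G^[j1] '' A) (hA.image' (cont_iter G j1)) ?_ _ ⟨a, ha, rfl⟩ _ ⟨x, hxA, rfl⟩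
  · linarith
  rintro i hi _ ⟨u, hu, rfl⟩ _ ⟨v, hv, rfl⟩
  constructor
  · rw [← Function.iterate_add_apply, ← Function.iterate_add_apply]
    exact (dist_triangle_right _ _ (G^[i + j1] x)).trans (add_le_add (fwd i hi u hu) (fwd i hi v hv))
  · exact (dist_triangle_right _ _ (G.symm^[i] (G^[j1] x))).trans
      (add_le_add (bwd i hi u hu) (bwd i hi v hv))

lemma lemH {G : R2 ≃ₜ R2} (hG : Equi G) (hE : Expa G) {r : ℝ} (hr : 0 < r) :
    ∃ δ > 0, ∀ w : R2, ∃ U, IsContinuum U ∧ w ∈ U ∧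
      (∀ u ∈ U, ∀ i : ℕ, dist (G.symm^[i] u) (G.symm^[i] w) ≤ r) ∧ ∃ u ∈ U, δ ≤ dist u w := by
  obtain ⟨N, hN⟩ := lemN hG hE hr (r + r)
  obtain ⟨δ', hδ', hδ2⟩ := unif hG N hr
  obtain ⟨δ, hδ, hδ1⟩ := unif hG.symm N hr
  refine ⟨δ', hδ', ?_⟩
  have dense : ∀ w : R2, ∀ s > 0, s < 1 / 4 → ∃ w', dist w' w ≤ s ∧ ∀ n, ∃ U, IsContinuum U ∧ w' ∈ U ∧
      (∀ u ∈ U, bow G.symm n w' u ≤ r) ∧ ∃ u ∈ U, δ' ≤ dist u w' := by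
    intro w s hs hs4
    by_contra hcon
    push Not at hcon
    have hlim : ∀ x : R2, ∃ L ∈ closedBall (0 : R2) 1,
        Tendsto (fun n => G.symm^[n] x - zv (fl (G.symm^[n] x))) (hyperfilter ℕ : Filter ℕ) (𝓝 L) := by
      intro x
      obtain ⟨L, hL, hLt⟩ := exists_lim (V := hyperfilter ℕ) (X := fun _ => closedBall (0 : R2) 1)
        (isCompact_closedBall (0 : R2) 1) (fun _ => Subset.rfl)
        (fun n => G.symm^[n] x - zv (fl (G.symm^[n] x))) (fun n => by simpa using fl_norm _)
      exact ⟨L, limset_subset isClosed_closedBall (fun _ => Subset.rfl) hL, hLt⟩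
    choose L hLB hLt using hlim
    let ws : ℕ → R2 := fun k => w + (s / (k + 1), 0)
    have hdw : ∀ k, dist (ws k) w ≤ s := by
      intro k
      simp only [ws, dist_self_add_left, Prod.norm_def, norm_zero, Real.norm_eq_abs]
      rw [abs_of_pos (by positivity)]
      refine max_le ?_ hs.le
      rw [div_le_iff₀ (by positivity)]
      nlinarith [(Nat.cast_nonneg k : (0 : ℝ) ≤ k)]
    obtain ⟨L0, -, φ, hφ, hφt⟩ := (isCompact_closedBall (0 : R2) 1).tendsto_subseq
      (x := fun k => L (ws k)) (fun k => hLB _)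
    obtain ⟨M, hM⟩ := Metric.cauchySeq_iff.1 hφt.cauchySeq (δ / 4) (by linarith)
    have h1 := hM M le_rfl (M + 1) (by omega)
    obtain ⟨n0, hn0⟩ := hcon (ws (φ M)) (hdw _)
    have heq := bad_eq hG hE (r := r) hδ h1.le (by
      linarith [dist_triangle_right (ws (φ M)) (ws (φ (M + 1))) w, hdw (φ M), hdw (φ (M + 1))])
      (hLt _) (hLt _) ⟨n0, bad_prop hr hδ hN hδ1 hδ2 hn0⟩
    have h2 : s / ((φ M : ℝ) + 1) = s / ((φ (M + 1) : ℝ) + 1) := by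
      have := congrArg Prod.fst heq
      simpa [ws] using this
    have h3 : φ M < φ (M + 1) := hφ (by omega)
    have h4 : (φ M : ℝ) < φ (M + 1) := by exact_mod_cast h3
    rw [div_eq_div_iff (by positivity) (by positivity)] at h2
    have := mul_left_cancel₀ hs.ne' h2
    linarith
  intro w
  choose ws hws hgood using fun n : ℕ => dense w (1 / ((n : ℝ) + 5)) (by positivity)
    (by rw [div_lt_div_iff₀ (by positivity) (by norm_num)]; linarith [(Nat.cast_nonneg n : (0 : ℝ) ≤ n)])
  refine limH ws ?_ ?_ fun n => hgood n n
  · rw [tendsto_iff_dist_tendsto_zero]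
    refine squeeze_zero (fun _ => dist_nonneg) hws ?_
    have := (tendsto_const_div_atTop_nhds_zero_nat (1 : ℝ)).comp (tendsto_add_atTop_nat 5)
    refine this.congr fun n => ?_
    simp
  · intro n
    refine (hws n).trans ?_
    rw [div_le_one (by positivity)]
    linarith [(Nat.cast_nonneg n : (0 : ℝ) ≤ n)]

end Unst

section Local

lemma IsContinuum.union' {X Y : Set R2} (hX : IsContinuum X) (hY : IsContinuum Y)
    (h : (X ∩ Y).Nonempty) : IsContinuum (X ∪ Y) :=
  ⟨hX.1.union hY.1, hX.2.union h hY.2⟩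

lemma box_cont {s s' t t' : ℝ} (hs : s ≤ s') (ht : t ≤ t') :
    IsContinuum (Icc s s' ×ˢ Icc t t' : Set R2) :=
  ⟨isCompact_Icc.prod isCompact_Icc, ⟨(s, t), ⟨le_rfl, hs⟩, ⟨le_rfl, ht⟩⟩,
    isPreconnected_Icc.prod isPreconnected_Icc⟩

/-- Crossing continua of a strip. -/
def Crosses (f : R2 → ℝ) (a b : ℝ) (A : Set R2) : Prop :=
  IsContinuum A ∧ (∀ p ∈ A, a ≤ f p ∧ f p ≤ b) ∧ (∃ p ∈ A, f p = a) ∧ ∃ p ∈ A, f p = b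

/-- Families of (unstable) continua. -/
structure UFam (𝒰 : Set (Set R2)) (r δ : ℝ) : Prop where
  cont : ∀ U ∈ 𝒰, IsContinuum U
  lim : ∀ U : ℕ → Set R2, (∀ n, U n ∈ 𝒰) → (∃ B, IsCompact B ∧ ∀ n, U n ⊆ B) →
    limset (hyperfilter ℕ) U ∈ 𝒰
  ex : ∀ w, ∃ U ∈ 𝒰, w ∈ U ∧ U ⊆ closedBall w r ∧ ∃ u ∈ U, δ ≤ dist u w

lemma half_pre {𝒰 : Set (Set R2)} {r δ a b h : ℝ} (hr : 0 < r) (hδ : 0 < δ) (h𝒰 : UFam 𝒰 r δ)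
    (hrab : r < (b - a) / 4)
    {A : Set R2} (hA : Crosses Prod.fst a b A) (hno : ∀ U ∈ 𝒰, U ⊆ A → U.Subsingleton)
    (hh : ∀ p ∈ A, |p.2| ≤ h) :
    ∃ U ∈ 𝒰, ∃ γ, (∀ p ∈ U, a ≤ p.1 ∧ p.1 ≤ b) ∧ (A ∩ U).Nonempty ∧ (U ∩ γ).Nonempty ∧
      IsContinuum γ ∧ (∀ p ∈ γ, a ≤ p.1 ∧ p.1 ≤ b) ∧ Disjoint A γ ∧ ∃ p ∈ γ, h + 2 ≤ p.2 := by
  obtain ⟨hAc, hAs, ⟨p0, hp0, hp0a⟩, q0, hq0, hq0b⟩ := hA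
  set c := (a + b) / 2 with hc
  have hca : a ≤ c := by rw [hc]; linarith
  have hcb : c ≤ b := by rw [hc]; linarith
  obtain ⟨x0, hx0, hx0c⟩ : ∃ x ∈ A, x.1 = c := by
    have := hAc.2.2.intermediate_value hp0 hq0 continuous_fst.continuousOn
    obtain ⟨x, hx, hxc⟩ := this (show c ∈ Icc p0.1 q0.1 by rw [hp0a, hq0b]; exact ⟨hca, hcb⟩)
    exact ⟨x, hx, hxc⟩
  have hcomp : IsCompact (A ∩ {x | x.1 = c}) :=
    hAc.1.inter_right (isClosed_eq continuous_fst continuous_const)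
  obtain ⟨z, ⟨hzA, hzc⟩, hzmax⟩ := hcomp.exists_isMaxOn ⟨x0, hx0, hx0c⟩ continuous_snd.continuousOn
  simp only [mem_ofPred_eq] at hzc
  let w : ℕ → R2 := fun m => (c, z.2 + 1 / ((m : ℝ) + 1))
  have hwpos : ∀ m : ℕ, (0 : ℝ) < 1 / ((m : ℝ) + 1) := fun m => by positivity
  have hwle : ∀ m : ℕ, 1 / ((m : ℝ) + 1) ≤ 1 := fun m => by
    rw [div_le_one (by positivity)]; linarith [(Nat.cast_nonneg m : (0 : ℝ) ≤ m)]
  have hzh := abs_le.1 (hh z hzA)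
  let σ : ℕ → Set R2 := fun m => Icc c c ×ˢ Icc (z.2 + 1 / ((m : ℝ) + 1)) (h + 2)
  have hσc : ∀ m, IsContinuum (σ m) := fun m => box_cont le_rfl (by linarith [hwle m])
  have hσs : ∀ m, ∀ p ∈ σ m, a ≤ p.1 ∧ p.1 ≤ b := by
    rintro m p ⟨⟨h1, h2⟩, -⟩; constructor <;> linarith
  have hσA : ∀ m, Disjoint A (σ m) := by
    intro m
    rw [disjoint_left]
    rintro p hp ⟨⟨h1, h2⟩, h3, -⟩
    have : p.2 ≤ z.2 := hzmax ⟨hp, le_antisymm h2 h1⟩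
    linarith [hwpos m]
  have hσw : ∀ m, w m ∈ σ m := fun m => ⟨⟨le_rfl, le_rfl⟩, le_rfl, by
    simp only [w]; linarith [hwle m]⟩
  have hσt : ∀ m, ∃ p ∈ σ m, h + 2 ≤ p.2 := fun m =>
    ⟨(c, h + 2), ⟨⟨le_rfl, le_rfl⟩, by simp only; linarith [hwle m], le_rfl⟩, le_rfl⟩
  choose U hU hwU hUr u hu hud using fun m => h𝒰.ex (w m)
  have hUs : ∀ m, ∀ p ∈ U m, a ≤ p.1 ∧ p.1 ≤ b := by
    intro m p hp
    have h1 : dist p.1 c ≤ r := (le_max_left _ _).trans (hUr m hp)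
    rw [Real.dist_eq, abs_le] at h1
    constructor <;> rw [hc] at h1 <;> linarith
  by_cases hmeet : ∃ m, (A ∩ U m).Nonempty
  · obtain ⟨m, hm⟩ := hmeet
    exact ⟨U m, hU m, σ m, hUs m, hm, ⟨w m, hwU m, hσw m⟩, hσc m, hσs m, hσA m, hσt m⟩
  push Not at hmeet
  have hUA : ∀ m, Disjoint A (U m) := fun m => disjoint_iff_inter_eq_empty.2 (hmeet m)
  have hwt : Tendsto w atTop (𝓝 z) := by
    have h1 : Tendsto (fun m : ℕ => z.2 + 1 / ((m : ℝ) + 1)) atTop (𝓝 (z.2 + 0)) :=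
      tendsto_const_nhds.add tendsto_one_div_add_atTop_nhds_zero_nat
    rw [add_zero] at h1
    have h2 : Tendsto (fun _ : ℕ => c) atTop (𝓝 z.1) := by rw [hzc]; exact tendsto_const_nhds
    exact h2.prodMk_nhds h1
  have hB : IsCompact (closedBall z (r + 1)) := isCompact_closedBall _ _
  have hUB : ∀ m, U m ⊆ closedBall z (r + 1) := by
    intro m p hp
    have h1 := hUr m hp
    have h2 : dist (w m) z ≤ 1 := by
      rw [Prod.dist_eq]
      simp only [w]
      refine max_le ?_ ?_
      · rw [hzc]; simp
      · rw [Real.dist_eq, abs_le]; constructor <;> linarith [hwpos m, hwle m]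
    rw [mem_closedBall] at *
    linarith [dist_triangle p (w m) z]
  have hLU := h𝒰.lim U hU ⟨_, hB, hUB⟩
  have hzL : z ∈ limset (hyperfilter ℕ) U := ⟨w, hwU, hwt.mono_left tendsto_hyper⟩
  obtain ⟨x, hx, y, hy, hxy⟩ := limset_big (V := hyperfilter ℕ) hB hUB (δ := δ)
    (fun n => ⟨u n, hu n, w n, hwU n, hud n⟩)
  have hLs : limset (hyperfilter ℕ) U ⊆ {p : R2 | a ≤ p.1 ∧ p.1 ≤ b} :=
    limset_subset ((isClosed_le continuous_const continuous_fst).inter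
      (isClosed_le continuous_fst continuous_const)) hUs
  obtain ⟨p, hpL, hpA⟩ : ∃ p ∈ limset (hyperfilter ℕ) U, p ∉ A := by
    by_contra hcon
    push Not at hcon
    have := hno _ hLU hcon hx hy
    rw [this, dist_self] at hxy
    linarith
  obtain ⟨ε, hε, hεA⟩ := Metric.isOpen_iff.1 hAc.1.isClosed.isOpen_compl p hpA
  obtain ⟨q, hq, hqt⟩ := id hpL
  obtain ⟨m, hm⟩ := (Metric.tendsto_nhds.1 hqt ε hε).exists
  have hseg : IsContinuum (segment ℝ (q m) p) := by
    refine ⟨?_, ⟨p, right_mem_segment ℝ _ _⟩, (convex_segment _ _).isPreconnected⟩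
    rw [segment_eq_image_lineMap]
    exact isCompact_Icc.image (by fun_prop)
  have hsegb : segment ℝ (q m) p ⊆ ball p ε :=
    (convex_ball p ε).segment_subset hm (mem_ball_self hε)
  have hcs : Convex ℝ {p : R2 | a ≤ p.1 ∧ p.1 ≤ b} := by
    have : {p : R2 | a ≤ p.1 ∧ p.1 ≤ b} = Icc a b ×ˢ univ := by
      ext p; simp
    rw [this]
    exact (convex_Icc a b).prod convex_univ
  have hsegs : segment ℝ (q m) p ⊆ {p : R2 | a ≤ p.1 ∧ p.1 ≤ b} :=
    hcs.segment_subset (hUs m _ (hq m)) (hLs hpL)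
  refine ⟨_, hLU, (σ m ∪ U m) ∪ segment ℝ (q m) p, fun s hs => hLs hs, ⟨z, hzA, hzL⟩,
    ⟨p, hpL, Or.inr (right_mem_segment ℝ _ _)⟩, ?_, ?_, ?_, ?_⟩
  · exact ((hσc m).union' (h𝒰.cont _ (hU m)) ⟨w m, hσw m, hwU m⟩).union' hseg
      ⟨q m, Or.inr (hq m), left_mem_segment ℝ _ _⟩
  · rintro s ((hs | hs) | hs)
    · exact hσs m s hs
    · exact hUs m s hs
    · exact hsegs hs
  · rw [disjoint_union_right, disjoint_union_right]
    refine ⟨⟨hσA m, hUA m⟩, ?_⟩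
    rw [disjoint_left]
    intro s hs hs'
    exact hεA (hsegb hs') hs
  · obtain ⟨t, ht, ht'⟩ := hσt m
    exact ⟨t, Or.inl (Or.inl ht), ht'⟩

lemma half {𝒰 : Set (Set R2)} {r δ a b : ℝ} (hr : 0 < r) (hδ : 0 < δ) (h𝒰 : UFam 𝒰 r δ)
    (hrab : r < (b - a) / 4)
    {A : Set R2} (hA : Crosses Prod.fst a b A) (hno : ∀ U ∈ 𝒰, U ⊆ A → U.Subsingleton) :
    ∃ U ∈ 𝒰, ∃ N, IsOpen N ∧ A ⊆ N ∧ ∀ A', Crosses Prod.fst a b A' → A' ⊆ N →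
      ∀ y y', (a, y) ∈ A → (a, y') ∈ A' → y < y' → (A' ∩ (A ∪ U)).Nonempty := by
  obtain ⟨h, hh⟩ : ∃ h, ∀ p ∈ A, |p.2| ≤ h := by
    obtain ⟨h, hh⟩ := hA.1.1.exists_bound_of_continuousOn (f := fun p : R2 => p.2)
      continuous_snd.continuousOn
    exact ⟨h, fun p hp => by simpa using hh p hp⟩
  obtain ⟨U, hU, γ, hUs, hAU, hUγ, hγ, hγs, hAγ, t, ht, hth⟩ := half_pre hr hδ h𝒰 hrab hA hno hh
  refine ⟨U, hU, {p | |p.2| < h + 1} ∩ γᶜ, ?_, ?_, ?_⟩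
  · exact (isOpen_lt (by fun_prop) continuous_const).inter hγ.1.isClosed.isOpen_compl
  · intro p hp
    exact ⟨by have := hh p hp; simp only [mem_ofPred_eq]; linarith,
      fun hp' => disjoint_left.1 hAγ hp hp'⟩
  rintro A' ⟨hA', hA's, -, ⟨b', y''⟩, hq, hqb⟩ hA'N y y' hy hy' hyy
  simp only at hqb
  subst hqb
  by_contra hcon
  have hdis : ∀ p ∈ A', p ∉ A ∪ U ∪ γ := by
    rintro p hp (hp' | hp')
    · exact hcon ⟨p, hp, hp'⟩
    · exact (hA'N hp).2 hp'
  obtain ⟨hAc, hAs, -, -⟩ := hA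
  have hW : ∀ p ∈ A ∪ U ∪ γ, a ≤ p.1 ∧ p.1 ≤ b' := by
    rintro p ((hp | hp) | hp)
    exacts [hAs p hp, hUs p hp, hγs p hp]
  have hWc : IsContinuum (A ∪ U ∪ γ) := by
    refine (hAc.union' (h𝒰.cont U hU) hAU).union' hγ ?_
    obtain ⟨s, hs, hs'⟩ := hUγ
    exact ⟨s, Or.inr hs, hs'⟩
  have hyh := abs_le.1 (hh _ hy)
  simp only at hyh
  have hA'y : ∀ p ∈ A', -(h + 1) ≤ p.2 ∧ p.2 ≤ h + 1 := fun p hp => by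
    have := (hA'N hp).1
    simp only [mem_ofPred_eq] at this
    exact abs_le.1 this.le
  let s1 : Set R2 := Icc (a - 1 / 2) (a - 1 / 2) ×ˢ Icc (-(h + 3)) y
  let s2 : Set R2 := Icc (a - 1 / 2) a ×ˢ Icc y y
  let t1 : Set R2 := Icc (a - 1) a ×ˢ Icc y' y'
  let t2 : Set R2 := Icc b' (b' + 1) ×ˢ Icc y'' y''
  have hab : a < b' := by linarith
  have hV : IsContinuum ((s1 ∪ s2) ∪ (A ∪ U ∪ γ)) := by
    refine ((box_cont le_rfl (by linarith)).union' (box_cont (by linarith) le_rfl)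
      ⟨(a - 1 / 2, y), ?_, ?_⟩).union' hWc ⟨(a, y), Or.inr ?_, Or.inl (Or.inl hy)⟩
    · exact ⟨⟨le_rfl, le_rfl⟩, by simp only; linarith, le_rfl⟩
    · exact ⟨⟨le_rfl, by simp only; linarith⟩, le_rfl, le_rfl⟩
    · exact ⟨⟨by simp only; linarith, le_rfl⟩, le_rfl, le_rfl⟩
  have hH : IsContinuum ((A' ∪ t1) ∪ t2) := by
    refine (hA'.union' (box_cont (by linarith) le_rfl) ⟨(a, y'), hy', ?_⟩).union'
      (box_cont (by linarith) le_rfl) ⟨(b', y''), Or.inl hq, ?_⟩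
    · exact ⟨⟨by simp only; linarith, le_rfl⟩, le_rfl, le_rfl⟩
    · exact ⟨⟨le_rfl, by simp only; linarith⟩, le_rfl, le_rfl⟩
  have := aux_cross hV hH (a := a - 1 / 2) (b := b') (c := -(h + 1)) (e := h + 1) ?_ ?_ ?_ ?_ ?_ ?_
  · obtain ⟨p, hp, hp'⟩ := this
    have hWt1 : p ∈ A ∪ U ∪ γ → p ∉ t1 := by
      rintro hp ⟨⟨h1, h2⟩, h3, h4⟩
      have : p = (a, y') := Prod.ext (le_antisymm h2 (hW p hp).1) (le_antisymm h4 h3)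
      exact hdis (a, y') hy' (this ▸ hp)
    have hWt2 : p ∈ A ∪ U ∪ γ → p ∉ t2 := by
      rintro hp ⟨⟨h1, h2⟩, h3, h4⟩
      have : p = (b', y'') := Prod.ext (le_antisymm (hW p hp).2 h1) (le_antisymm h4 h3)
      exact hdis (b', y'') hq (this ▸ hp)
    rcases hp with (⟨⟨h1, h2⟩, h3, h4⟩ | ⟨⟨h1, h2⟩, h3, h4⟩) | hp
    · rcases hp' with (hp' | ⟨⟨k1, k2⟩, k3, k4⟩) | ⟨⟨k1, k2⟩, k3, k4⟩
      · linarith [(hA's p hp').1]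
      · linarith
      · linarith
    · rcases hp' with (hp' | ⟨⟨k1, k2⟩, k3, k4⟩) | ⟨⟨k1, k2⟩, k3, k4⟩
      · have : p = (a, y) := Prod.ext (le_antisymm h2 (hA's p hp').1) (le_antisymm h4 h3)
        exact hdis p hp' (Or.inl (Or.inl (this ▸ hy)))
      · linarith
      · linarith
    · rcases hp' with (hp' | hp') | hp'
      · exact hdis p hp' hp
      · exact hWt1 hp hp'
      · exact hWt2 hp hp'
  · rintro p ((⟨⟨h1, h2⟩, h3, h4⟩ | ⟨⟨h1, h2⟩, h3, h4⟩) | hp)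
    · constructor <;> linarith
    · constructor <;> linarith
    · have := hW p hp
      constructor <;> linarith
  · rintro p ((hp | ⟨⟨k1, k2⟩, k3, k4⟩) | ⟨⟨k1, k2⟩, k3, k4⟩)
    · exact hA'y p hp
    · have := hA'y _ hy'
      simp only at this
      constructor <;> linarith
    · have := hA'y _ hq
      simp only at this
      constructor <;> linarith
  · exact ⟨(a - 1 / 2, -(h + 3)), Or.inl (Or.inl ⟨⟨le_rfl, le_rfl⟩, le_rfl, by
      simp only; linarith⟩), by simp only; linarith⟩
  · exact ⟨t, Or.inr (Or.inr ht), by linarith⟩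
  · exact ⟨(a - 1, y'), Or.inl (Or.inr ⟨⟨le_rfl, by simp only; linarith⟩, le_rfl, le_rfl⟩), by
      simp only; linarith⟩
  · exact ⟨(b' + 1, y''), Or.inr ⟨⟨by simp only; linarith, le_rfl⟩, le_rfl, le_rfl⟩, by
      simp only; linarith⟩

end Local

section Fin

lemma invol_image {σ : R2 → R2} (hinv : ∀ x, σ (σ x) = x) (S : Set R2) : σ '' (σ '' S) = S := by
  rw [image_image]; simp [hinv]

lemma invol_mem {σ : R2 → R2} (hinv : ∀ x, σ (σ x) = x) {S : Set R2} {x : R2} (h : x ∈ σ '' S) :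
    σ x ∈ S := by
  obtain ⟨y, hy, rfl⟩ := h
  rwa [hinv]

lemma limset_image {ι : Type*} {V : Ultrafilter ι} {X : ι → Set R2} {σ : R2 → R2}
    (hσ : Continuous σ) (hinv : ∀ x, σ (σ x) = x) :
    σ '' limset V X = limset V (fun i => σ '' X i) := by
  ext x
  constructor
  · rintro ⟨y, ⟨p, hp, hpt⟩, rfl⟩
    exact ⟨fun i => σ (p i), fun i => ⟨p i, hp i, rfl⟩, (hσ.tendsto y).comp hpt⟩
  · rintro ⟨p, hp, hpt⟩
    exact ⟨σ x, ⟨fun i => σ (p i), fun i => invol_mem hinv (hp i), (hσ.tendsto x).comp hpt⟩, hinv x⟩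

lemma UFam.map {𝒰 : Set (Set R2)} {r δ : ℝ} (h : UFam 𝒰 r δ) {σ : R2 → R2}
    (hσ : Isometry σ) (hinv : ∀ x, σ (σ x) = x) : UFam {S | σ '' S ∈ 𝒰} r δ where
  cont := fun U hU => by
    have := (h.cont _ hU).image' hσ.continuous
    rwa [invol_image hinv] at this
  lim := fun U hU ⟨B, hB, hUB⟩ => by
    have := h.lim (fun n => σ '' U n) hU ⟨σ '' B, hB.image hσ.continuous, fun n => image_mono (hUB n)⟩
    rw [← limset_image hσ.continuous hinv] at this
    exact this
  ex := fun w => by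
    obtain ⟨U, hU, hwU, hUr, u, hu, hud⟩ := h.ex (σ w)
    refine ⟨σ '' U, ?_, ⟨σ w, hwU, hinv w⟩, ?_, σ u, ⟨u, hu, rfl⟩, ?_⟩
    · change σ '' (σ '' U) ∈ 𝒰
      rwa [invol_image hinv]
    · rintro _ ⟨u, hu, rfl⟩
      have := hUr hu
      rw [mem_closedBall] at *
      rwa [← hinv w, hσ.dist_eq]
    · rw [← hinv w, hσ.dist_eq]; exact hud

lemma Crosses.map {f g : R2 → ℝ} {a b : ℝ} {A : Set R2} (h : Crosses f a b A) {σ : R2 → R2}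
    (hσ : Isometry σ) (hg : ∀ x, g (σ x) = f x) : Crosses g a b (σ '' A) := by
  obtain ⟨h1, h2, ⟨p, hp, hpa⟩, q, hq, hqb⟩ := h
  refine ⟨h1.image' hσ.continuous, ?_, ⟨σ p, ⟨p, hp, rfl⟩, by rw [hg, hpa]⟩,
    σ q, ⟨q, hq, rfl⟩, by rw [hg, hqb]⟩
  rintro _ ⟨x, hx, rfl⟩
  rw [hg]
  exact h2 x hx

lemma no_map {𝒰 : Set (Set R2)} {A : Set R2} (hno : ∀ U ∈ 𝒰, U ⊆ A → U.Subsingleton)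
    {σ : R2 → R2} (hinv : ∀ x, σ (σ x) = x) :
    ∀ U ∈ {S | σ '' S ∈ 𝒰}, U ⊆ σ '' A → U.Subsingleton := by
  intro U hU hUA
  have := hno _ hU (by have := image_mono (f := σ) hUA; rwa [invol_image hinv] at this)
  have := this.image σ
  rwa [invol_image hinv] at this

/-- Reflection. -/
def refl2 (p : R2) : R2 := (p.1, -p.2)

lemma refl2_iso : Isometry refl2 := by
  refine Isometry.of_dist_eq fun x y => ?_
  simp [refl2, Prod.dist_eq]

lemma refl2_inv (x : R2) : refl2 (refl2 x) = x := by simp [refl2]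

lemma swap_iso : Isometry (Prod.swap : R2 → R2) := by
  refine Isometry.of_dist_eq fun x y => ?_
  simp [Prod.dist_eq, max_comm]

lemma both {𝒰 : Set (Set R2)} {r δ a b : ℝ} (hr : 0 < r) (hδ : 0 < δ) (h𝒰 : UFam 𝒰 r δ)
    (hrab : r < (b - a) / 4)
    {A : Set R2} (hA : Crosses Prod.fst a b A) (hno : ∀ U ∈ 𝒰, U ⊆ A → U.Subsingleton) :
    ∃ U1 ∈ 𝒰, ∃ U2 ∈ 𝒰, ∃ N, IsOpen N ∧ A ⊆ N ∧ ∀ A', Crosses Prod.fst a b A' → A' ⊆ N →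
      (A' ∩ (A ∪ U1 ∪ U2)).Nonempty := by
  obtain ⟨U1, hU1, N1, hN1, hAN1, h1⟩ := half hr hδ h𝒰 hrab hA hno
  obtain ⟨U2, hU2, N2, hN2, hAN2, h2⟩ := half hr hδ (h𝒰.map refl2_iso refl2_inv) hrab
    (hA.map (g := Prod.fst) refl2_iso (fun x => rfl)) (no_map hno refl2_inv)
  refine ⟨U1, hU1, refl2 '' U2, hU2, N1 ∩ refl2 ⁻¹' N2,
    hN1.inter (hN2.preimage refl2_iso.continuous),
    fun p hp => ⟨hAN1 hp, hAN2 ⟨p, hp, rfl⟩⟩, ?_⟩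
  intro A' hA' hA'N
  obtain ⟨⟨a1, y⟩, hy, ha1⟩ := hA.2.2.1
  obtain ⟨⟨a2, y'⟩, hy', ha2⟩ := hA'.2.2.1
  simp only at ha1 ha2
  subst ha1
  subst ha2
  rcases lt_trichotomy y y' with hlt | rfl | hlt
  · obtain ⟨p, hp, hp'⟩ := h1 A' hA' (fun p hp => (hA'N hp).1) y y' hy hy' hlt
    exact ⟨p, hp, Or.inl hp'⟩
  · exact ⟨_, hy', Or.inl (Or.inl hy)⟩
  · obtain ⟨p, hp, hp'⟩ := h2 (refl2 '' A') (hA'.map refl2_iso (fun x => rfl))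
      (by rintro _ ⟨p, hp, rfl⟩; exact (hA'N hp).2) (-y) (-y') ⟨_, hy, rfl⟩ ⟨_, hy', rfl⟩
      (by linarith)
    refine ⟨refl2 p, invol_mem refl2_inv hp, ?_⟩
    rcases hp' with hp' | hp'
    · exact Or.inl (Or.inl (invol_mem refl2_inv hp'))
    · exact Or.inr ⟨p, hp', rfl⟩

lemma both_snd {𝒰 : Set (Set R2)} {r δ a b : ℝ} (hr : 0 < r) (hδ : 0 < δ) (h𝒰 : UFam 𝒰 r δ)
    (hrab : r < (b - a) / 4)
    {A : Set R2} (hA : Crosses Prod.snd a b A) (hno : ∀ U ∈ 𝒰, U ⊆ A → U.Subsingleton) :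
    ∃ U1 ∈ 𝒰, ∃ U2 ∈ 𝒰, ∃ N, IsOpen N ∧ A ⊆ N ∧ ∀ A', Crosses Prod.snd a b A' → A' ⊆ N →
      (A' ∩ (A ∪ U1 ∪ U2)).Nonempty := by
  obtain ⟨U1, hU1, U2, hU2, N, hN, hAN, h⟩ := both hr hδ (h𝒰.map swap_iso Prod.swap_swap) hrab
    (hA.map (g := Prod.fst) swap_iso (fun x => rfl)) (no_map hno Prod.swap_swap)
  refine ⟨_, hU1, _, hU2, Prod.swap ⁻¹' N, hN.preimage continuous_swap,
    fun p hp => hAN ⟨p, hp, rfl⟩, ?_⟩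
  intro A' hA' hA'N
  obtain ⟨p, hp, hp'⟩ := h (Prod.swap '' A') (hA'.map swap_iso (fun x => rfl))
    (by rintro _ ⟨p, hp, rfl⟩; exact hA'N hp)
  refine ⟨p.swap, invol_mem Prod.swap_swap hp, ?_⟩
  rcases hp' with (hp' | hp') | hp'
  · exact Or.inl (Or.inl (invol_mem Prod.swap_swap hp'))
  · exact Or.inl (Or.inr ⟨p, hp', rfl⟩)
  · exact Or.inr ⟨p, hp', rfl⟩

lemma unst_fam {G : R2 ≃ₜ R2} (hG : Equi G) (hE : Expa G) {r : ℝ} (hr : 0 < r) (hr2 : r ≤ 1 / 2) :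
    ∃ δ > 0, UFam {U | IsContinuum U ∧ FB G.symm 1 U} r δ := by
  obtain ⟨δ, hδ, h⟩ := lemH hG hE hr
  refine ⟨δ, hδ, fun U hU => hU.1, ?_, ?_⟩
  · rintro U hU ⟨B, hB, hUB⟩
    refine ⟨limset_continuum hB hUB fun n => (hU n).1, fun j => ?_⟩
    exact limset_bound (cont_iter G.symm j) (Eventually.of_forall fun n => (hU n).2 j)
  · intro w
    obtain ⟨U, hU, hwU, hb, u, hu, hud⟩ := h w
    refine ⟨U, ⟨hU, ?_⟩, hwU, fun x hx => hb x hx 0, u, hu, hud⟩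
    intro j x hx y hy
    linarith [dist_triangle_right (G.symm^[j] x) (G.symm^[j] y) (G.symm^[j] w), hb x hx j, hb y hy j]

/-- Sets that are bounded in the past or in the future. -/
def GoodP (G : R2 ≃ₜ R2) (P : Set R2) : Prop := FB G 1 P ∨ FB G.symm 1 P

lemma finite_type {G : R2 ≃ₜ R2} {f : R2 → ℝ} (hf : Continuous f) {a b : ℝ} {B : Set R2}
    (hB : IsCompact B)
    (hloc : ∀ A, Crosses f a b A → FB G 1 A → ∃ U1, GoodP G U1 ∧ ∃ U2, GoodP G U2 ∧
      ∃ N, IsOpen N ∧ A ⊆ N ∧ ∀ A', Crosses f a b A' → A' ⊆ N → (A' ∩ (A ∪ U1 ∪ U2)).Nonempty) :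
    ∃ PP : Set (Set R2), PP.Finite ∧ (∀ P ∈ PP, GoodP G P) ∧
      ∀ A', Crosses f a b A' → FB G 1 A' → A' ⊆ B → ∃ P ∈ PP, (A' ∩ P).Nonempty := by
  by_contra hcon
  push Not at hcon
  let 𝒞 : Set (Set R2) := {A | Crosses f a b A ∧ FB G 1 A ∧ A ⊆ B}
  have hloc' : ∀ A : 𝒞, ∃ U1, GoodP G U1 ∧ ∃ U2, GoodP G U2 ∧
      ∃ N, IsOpen N ∧ A.1 ⊆ N ∧ ∀ A', Crosses f a b A' → A' ⊆ N → (A' ∩ (A ∪ U1 ∪ U2)).Nonempty :=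
    fun A => hloc A.1 A.2.1 A.2.2.1
  choose U1 hU1 U2 hU2 N hN hAN hh using hloc'
  have hX : ∀ s : Finset 𝒞, ∃ X : Set R2, X ∈ 𝒞 ∧ ∀ A ∈ s, ¬ X ⊆ N A := by
    intro s
    obtain ⟨X, hX1, hX2, hX3, hX4⟩ := hcon
      (⋃ A ∈ s, ({A.1, U1 A, U2 A} : Set (Set R2)))
      (s.finite_toSet.biUnion fun A _ => by simp) (by
        intro P hP
        simp only [mem_iUnion] at hP
        obtain ⟨A, hA, rfl | rfl | rfl⟩ := hP
        · exact Or.inl A.2.2.1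
        · exact hU1 A
        · exact hU2 A)
    refine ⟨X, ⟨hX1, hX2, hX3⟩, fun A hA hXN => ?_⟩
    have hmem : ∀ P ∈ ({A.1, U1 A, U2 A} : Set (Set R2)), X ∩ P = ∅ := fun P hP =>
      hX4 P (mem_iUnion₂.2 ⟨A, hA, hP⟩)
    obtain ⟨p, hp, (hp' | hp') | hp'⟩ := hh A X hX1 hXN
    · exact (hmem A.1 (by simp)).le ⟨hp, hp'⟩
    · exact (hmem (U1 A) (by simp)).le ⟨hp, hp'⟩
    · exact (hmem (U2 A) (by simp)).le ⟨hp, hp'⟩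
  choose X hXC hXN using hX
  classical
  let V : Ultrafilter (Finset 𝒞) := Ultrafilter.of atTop
  have hXB : ∀ s, X s ⊆ B := fun s => (hXC s).2.2
  have hLcont : IsContinuum (limset V X) := limset_continuum hB hXB fun s => (hXC s).1.1
  have hL : limset V X ∈ 𝒞 := by
    refine ⟨⟨hLcont, ?_, ?_, ?_⟩, ?_, limset_subset hB.isClosed hXB⟩
    · exact limset_subset (B := {p | a ≤ f p ∧ f p ≤ b}) ((isClosed_le continuous_const hf).inter
        (isClosed_le hf continuous_const)) fun s => (hXC s).1.2.1
    · choose p hp hpa using fun s => (hXC s).1.2.2.1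
      obtain ⟨x, hx, hxt⟩ := exists_lim (V := V) hB hXB p hp
      refine ⟨x, hx, tendsto_nhds_unique ((hf.tendsto x).comp hxt) ?_⟩
      exact tendsto_const_nhds.congr fun s => (hpa s).symm
    · choose p hp hpa using fun s => (hXC s).1.2.2.2
      obtain ⟨x, hx, hxt⟩ := exists_lim (V := V) hB hXB p hp
      refine ⟨x, hx, tendsto_nhds_unique ((hf.tendsto x).comp hxt) ?_⟩
      exact tendsto_const_nhds.congr fun s => (hpa s).symm
    · exact fun j => limset_bound (cont_iter G j) (Eventually.of_forall fun s => (hXC s).2.1 j)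
  have e1 := limset_nhds (V := V) hB hXB (fun s => (hXC s).1.1.2.1) (hN ⟨_, hL⟩) (hAN ⟨_, hL⟩)
  have e2 : ∀ᶠ s in (V : Filter (Finset 𝒞)), ({⟨_, hL⟩} : Finset 𝒞) ≤ s :=
    Ultrafilter.of_le atTop (eventually_ge_atTop _)
  obtain ⟨s, h1, h2⟩ := (e1.and e2).exists
  exact hXN s ⟨_, hL⟩ (h2 (Finset.mem_singleton_self _)) h1

lemma lemF {G : R2 ≃ₜ R2} (hG : Equi G) (hE : Expa G) {δ R : ℝ} (hδ : 0 < δ) :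
    ∃ PP : Set (Set R2), PP.Finite ∧ (∀ P ∈ PP, GoodP G P) ∧
      ∀ A, IsContinuum A → FB G 1 A → A ⊆ closedBall 0 R →
        (∃ p ∈ A, ∃ q ∈ A, δ ≤ dist p q) → ∃ P ∈ PP, (A ∩ P).Nonempty := by
  set η := δ / 3 with hη
  have hηp : 0 < η := by positivity
  obtain ⟨δ', hδ', hfam⟩ := unst_fam hG hE (r := min (1 / 2) (η / 5)) (by positivity)
    (min_le_left _ _)
  have hno : ∀ A, FB G 1 A → ∀ U ∈ {U | IsContinuum U ∧ FB G.symm 1 U}, U ⊆ A → U.Subsingleton :=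
    fun A hA U hU hUA => hE U hU.1 1 (hA.mono hUA le_rfl) hU.2
  have hrr : ∀ k : ℤ, min (1 / 2) (η / 5) < (((k : ℝ) + 1) * η - k * η) / 4 := fun k =>
    (min_le_right _ _).trans_lt (by linarith)
  have h1 : ∀ k : ℤ, _ := fun k => finite_type (G := G) continuous_fst (a := k * η)
    (b := (k + 1) * η) (isCompact_closedBall (0 : R2) R) (fun A hA hAF => by
      obtain ⟨U1, hU1, U2, hU2, h⟩ := both (by positivity) hδ' hfam (hrr k) hA (hno A hAF)
      exact ⟨U1, Or.inr hU1.2, U2, Or.inr hU2.2, h⟩)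
  have h2 : ∀ k : ℤ, _ := fun k => finite_type (G := G) continuous_snd (a := k * η)
    (b := (k + 1) * η) (isCompact_closedBall (0 : R2) R) (fun A hA hAF => by
      obtain ⟨U1, hU1, U2, hU2, h⟩ := both_snd (by positivity) hδ' hfam (hrr k) hA (hno A hAF)
      exact ⟨U1, Or.inr hU1.2, U2, Or.inr hU2.2, h⟩)
  choose P1 hP1f hP1g hP1 using h1
  choose P2 hP2f hP2g hP2 using h2
  let I : Finset ℤ := Finset.Icc ⌈-R / η⌉ ⌈R / η⌉
  have key : ∀ (f : R2 → ℝ), Continuous f → (∀ p, |f p| ≤ ‖p‖) → ∀ A, IsContinuum A → FB G 1 A →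
      A ⊆ closedBall 0 R → ∀ p ∈ A, ∀ q ∈ A, δ ≤ f q - f p →
      ∃ k ∈ I, ∃ A' ⊆ A, Crosses f (k * η) ((k + 1) * η) A' := by
    intro f hf hfn A hA hAF hAB p hp q hq hpq
    have hpR : |f p| ≤ R := (hfn p).trans (by simpa using hAB hp)
    rw [abs_le] at hpR
    refine ⟨⌈f p / η⌉, ?_, ?_⟩
    · simp only [I, Finset.mem_Icc]
      constructor <;> apply Int.ceil_mono <;> gcongr <;> linarith
    · have c1 : f p ≤ ⌈f p / η⌉ * η := by
        have := Int.le_ceil (f p / η)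
        rwa [div_le_iff₀ hηp] at this
      have c2 : (⌈f p / η⌉ + 1) * η ≤ f q := by
        have := (Int.ceil_lt_add_one (f p / η)).le
        have := mul_le_mul_of_nonneg_right this hηp.le
        rw [add_mul, div_mul_cancel₀ _ hηp.ne'] at this
        rw [add_mul]
        linarith
      obtain ⟨A', hA'A, h1, h2, h3, h4⟩ := aux_strip hA hf (by nlinarith) hp hq c1 c2
      exact ⟨A', hA'A, h1, h2, h3, h4⟩
  refine ⟨⋃ k ∈ I, (P1 k ∪ P2 k), I.finite_toSet.biUnion fun k _ => (hP1f k).union (hP2f k), ?_, ?_⟩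
  · intro P hP
    simp only [mem_iUnion] at hP
    obtain ⟨k, -, hP | hP⟩ := hP
    exacts [hP1g k P hP, hP2g k P hP]
  · rintro A hA hAF hAB ⟨p, hp, q, hq, hpq⟩
    have case1 : ∀ p ∈ A, ∀ q ∈ A, δ ≤ q.1 - p.1 →
        ∃ P ∈ ⋃ k ∈ I, (P1 k ∪ P2 k), (A ∩ P).Nonempty := by
      intro p hp q hq h
      obtain ⟨k, hk, A', hA'A, hc⟩ := key Prod.fst continuous_fst (fun p => norm_fst_le p) A hA hAF
        hAB p hp q hq h
      obtain ⟨P, hP, hPA⟩ := hP1 k A' hc (hAF.mono hA'A le_rfl) (hA'A.trans hAB)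
      exact ⟨P, mem_iUnion₂.2 ⟨k, hk, Or.inl hP⟩, hPA.mono (inter_subset_inter_left _ hA'A)⟩
    have case2 : ∀ p ∈ A, ∀ q ∈ A, δ ≤ q.2 - p.2 →
        ∃ P ∈ ⋃ k ∈ I, (P1 k ∪ P2 k), (A ∩ P).Nonempty := by
      intro p hp q hq h
      obtain ⟨k, hk, A', hA'A, hc⟩ := key Prod.snd continuous_snd (fun p => norm_snd_le p) A hA hAF
        hAB p hp q hq h
      obtain ⟨P, hP, hPA⟩ := hP2 k A' hc (hAF.mono hA'A le_rfl) (hA'A.trans hAB)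
      exact ⟨P, mem_iUnion₂.2 ⟨k, hk, Or.inr hP⟩, hPA.mono (inter_subset_inter_left _ hA'A)⟩
    rw [Prod.dist_eq, le_max_iff, Real.dist_eq, Real.dist_eq, le_abs, le_abs] at hpq
    rcases hpq with (h | h) | (h | h)
    · exact case1 q hq p hp h
    · exact case1 p hp q hq (by linarith)
    · exact case2 q hq p hp h
    · exact case2 p hp q hq (by linarith)

end Fin

lemma sep_iter {H : R2 ≃ₜ R2} (hH : Equi H) {P : Set R2} (hP : FB H 1 P) {u u' : R2}
    {v v' : ℤ × ℤ} (hu : u - zv v ∈ P) (hu' : u' - zv v' ∈ P) (j : ℕ) :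
    dist (zv v) (zv v') - 1 ≤ dist (H^[j] u) (H^[j] u') := by
  have h := hP j _ hu _ hu'
  rw [hH.iter_sub, hH.iter_sub] at h
  rw [dist_eq_norm] at h ⊢
  rw [dist_eq_norm]
  have e : zv v - zv v' = (H^[j] u - H^[j] u') - ((H^[j] u - zv v) - (H^[j] u' - zv v')) := by abel
  have := norm_sub_le (H^[j] u - H^[j] u') ((H^[j] u - zv v) - (H^[j] u' - zv v'))
  rw [← e] at this
  linarith

lemma core {G : R2 ≃ₜ R2} (hG : Equi G) (hE : Expa G) {d : ℝ} (hd : 0 < d) :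
    ∃ L : ℝ, 0 < L ∧ ∀ (z : R2) (K : Set R2), IsContinuum K → K ⊆ stableSet G z →
      ∀ f : R2 → ℝ, Continuous f → (∀ x y, |f x - f y| ≤ dist x y) →
      (∃ x ∈ K, ∃ y ∈ K, L < f y - f x) →
      ∃ u ∈ K, ∃ u' ∈ K, ∀ j : ℕ, d + 1 ≤ dist (G.symm^[j] u) (G.symm^[j] u') := by
  obtain ⟨δ, hδ, hQ⟩ := lemQ hG hE
  obtain ⟨PP, hfin, hgood, hhit⟩ := lemF hG hE (δ := δ) (R := 2) hδ
  refine ⟨(d + 5) * (hfin.toFinset.card + 2), by positivity, ?_⟩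
  rintro z K hK hKs f hf hlip ⟨x, hx, y, hy, hxy⟩
  set n := hfin.toFinset.card with hn
  have hpos : (0:ℝ) ≤ (d + 5) * n := by positivity
  have hL2 : 2 < f y - f x := by nlinarith
  have hpt : ∀ i : Fin (n + 1), ∃ p ∈ K, f p = f x + (d + 5) * (i : ℕ) := by
    intro i
    have hi : ((i : ℕ) : ℝ) ≤ n := by exact_mod_cast Nat.lt_succ_iff.1 i.2
    have := hK.2.isPreconnected.intermediate_value hx hy hf.continuousOn
    obtain ⟨p, hp, hp'⟩ := this (show f x + (d + 5) * (i : ℕ) ∈ Icc (f x) (f y) from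
      ⟨le_add_of_nonneg_right (by positivity), by nlinarith⟩)
    exact ⟨p, hp, hp'⟩
  choose p hpK hpf using hpt
  have hstep : ∀ i, ∃ P ∈ PP, ∃ u ∈ K, u - zv (fl (p i)) ∈ P := by
    intro i
    have hfar : ∃ w ∈ K, 1 ≤ dist w (p i) := by
      by_contra! hcon
      have h1 := (abs_le.1 (hlip x (p i))).1
      have h2 := (abs_le.1 (hlip y (p i))).2
      linarith [hcon x hx, hcon y hy]
    obtain ⟨w, hw, hwd⟩ := hfar
    obtain ⟨X, hXK, hX, hpX, hXle, a, haX, ha⟩ := aux_bump hK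
      (f := fun q => dist q (p i)) (by fun_prop) (hpK i) hw (r := 1) (by simp) hwd
    obtain ⟨X', hX', m, hX'c, hX'FB, hbig⟩ := lemP hX (hXK.trans hKs)
      ⟨a, haX, p i, hpX, ha.ge⟩
    obtain ⟨A, hAX, hA, hAFB, a, haA, b, hbA, hab⟩ := hQ X' m hX'c hX'FB hbig
    have hsub := hAX.trans hX'
    obtain ⟨P, hP, q, ⟨u, hu, rfl⟩, hqP⟩ := hhit ((fun q => q - zv (fl (p i))) '' A)
      ⟨hA.1.image (by fun_prop), hA.2.image _ (by fun_prop)⟩ (hAFB.translate hG _)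
      (by
        rintro _ ⟨q, hq, rfl⟩
        rw [mem_closedBall, dist_zero_right]
        have h1 := hXle q (hsub hq)
        have h2 := fl_norm (p i)
        rw [dist_eq_norm] at h1
        calc ‖q - zv (fl (p i))‖ = ‖(q - p i) + (p i - zv (fl (p i)))‖ := by congr 1; abel
          _ ≤ _ := norm_add_le _ _
          _ ≤ 2 := by linarith)
      ⟨_, ⟨a, haA, rfl⟩, _, ⟨b, hbA, rfl⟩, by simpa only [dist_sub_right] using hab⟩
    exact ⟨P, hP, u, hXK (hsub hu), hqP⟩
  choose P hP u huK huP using hstep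
  obtain ⟨i, -, i', -, hne, heq⟩ := Finset.exists_ne_map_eq_of_card_lt_of_maps_to
    (s := (Finset.univ : Finset (Fin (n + 1)))) (t := hfin.toFinset) (f := P)
    (by simp [← hn]) (fun i _ => by simpa using hP i)
  have hdist : d + 3 ≤ dist (zv (fl (p i))) (zv (fl (p i'))) := by
    have h1 : d + 5 ≤ dist (p i) (p i') := by
      refine le_trans ?_ (hlip _ _)
      rw [hpf, hpf, show f x + (d + 5) * ((i:ℕ):ℝ) - (f x + (d + 5) * ((i':ℕ):ℝ))
        = (d + 5) * (((i:ℕ):ℝ) - ((i':ℕ):ℝ)) by ring, abs_mul, abs_of_pos (by linarith : 0 < d + 5)]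
      have h0 : (1:ℝ) ≤ |((i:ℕ):ℝ) - ((i':ℕ):ℝ)| := by
        have : ((i:ℕ):ℤ) - ((i':ℕ):ℤ) ≠ 0 := by
          intro h; apply hne; apply Fin.ext; omega
        have := Int.one_le_abs this
        exact_mod_cast this
      nlinarith
    have h2 := fl_norm (p i)
    have h3 := fl_norm (p i')
    rw [← dist_eq_norm] at h2 h3
    have h4 := dist_triangle4 (p i) (zv (fl (p i))) (zv (fl (p i'))) (p i')
    rw [dist_comm (zv (fl (p i'))) (p i')] at h4
    linarith
  have hu' := huP i'
  rw [← heq] at hu'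
  refine ⟨u i, huK i, u i', huK i', fun j => ?_⟩
  rcases hgood _ (hP i) with hg | hg
  · exfalso
    obtain ⟨J, hJ⟩ := stable_asym hG hE (hKs (huK i)) (ε := 1) one_pos
    obtain ⟨J', hJ'⟩ := stable_asym hG hE (hKs (huK i')) (ε := 1) one_pos
    have h1 := hJ _ (le_max_left J J')
    have h2 := hJ' _ (le_max_right J J')
    have h3 := sep_iter hG hg (huP i) hu' (max J J')
    have h4 := dist_triangle_right (G^[max J J'] (u i)) (G^[max J J'] (u i')) (G^[max J J'] z)
    linarith
  · have h3 := sep_iter hG.symm hg (huP i) hu' j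
    linarith

lemma expa_of {G : R2 ≃ₜ R2}
    (hexp : ∀ K : Set R2, IsContinuum K → K.Nontrivial → dynDiam G K = ⊤) : Expa G := by
  intro K hK M h1 h2
  by_contra hns
  have htop := hexp K hK (not_subsingleton_iff.1 hns)
  have : dynDiam G K ≤ ENNReal.ofReal M := by
    refine iSup_le fun j => ?_
    refine Metric.ediam_le ?_
    rintro _ ⟨x, hx, rfl⟩ _ ⟨y, hy, rfl⟩
    rw [edist_dist]
    refine ENNReal.ofReal_le_ofReal ?_
    cases j with
    | ofNat n => exact h1 n x hx y hy
    | negSucc n => exact h2 (n + 1) x hx y hy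
  rw [htop] at this
  exact ENNReal.ofReal_ne_top (top_le_iff.1 this)



/-- Large stable continua stay large in the past: there is `L_d` such that any stable
continuum of diameter greater than `L_d` has all its past iterates of diameter
greater than `d`. -/
theorem large_stable_continua_large_past
    (g : Torus ≃ₜ Torus) (G : R2 ≃ₜ R2) (hG : IsLiftFun ⇑g ⇑G)
    (hrot : (interior (rotSet G)).Nonempty)
    (hexp : ∀ K : Set R2, IsContinuum K → K.Nontrivial → dynDiam G K = ⊤)
    (d : ℝ) (hd : 0 < d) :
    ∃ L : ℝ, 0 < L ∧ ∀ (z : R2) (K : Set R2), IsContinuum K → K ⊆ stableSet G z →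
      ENNReal.ofReal L < EMetric.diam K →
      ∀ j : ℤ, j < 0 → ENNReal.ofReal d < EMetric.diam (iterZ G j '' K) := by
  have hEq : Equi G := fun x v => hG.2 x v
  obtain ⟨L, hL, hcore⟩ := core hEq (expa_of hexp) hd
  refine ⟨L, hL, fun z K hK hKs hdiam j hj => ?_⟩
  have hxy : ∃ x ∈ K, ∃ y ∈ K, L < dist x y := by
    by_contra! hcon
    refine absurd hdiam (not_lt.2 (Metric.ediam_le fun x hx y hy => ?_))
    rw [edist_dist]
    exact ENNReal.ofReal_le_ofReal (hcon x hx y hy)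
  obtain ⟨x, hx, y, hy, hxy⟩ := hxy
  have key : ∃ u ∈ K, ∃ u' ∈ K, ∀ j : ℕ, d + 1 ≤ dist (G.symm^[j] u) (G.symm^[j] u') := by
    rw [Prod.dist_eq, lt_max_iff, Real.dist_eq, Real.dist_eq, lt_abs, lt_abs] at hxy
    have l1 : ∀ a b : R2, |a.1 - b.1| ≤ dist a b := fun a b => by
      rw [← Real.dist_eq]; exact le_max_left _ _
    have l2 : ∀ a b : R2, |a.2 - b.2| ≤ dist a b := fun a b => by
      rw [← Real.dist_eq]; exact le_max_right _ _
    rcases hxy with (h | h) | (h | h)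
    · exact hcore z K hK hKs Prod.fst continuous_fst l1 ⟨y, hy, x, hx, h⟩
    · exact hcore z K hK hKs Prod.fst continuous_fst l1 ⟨x, hx, y, hy, by linarith⟩
    · exact hcore z K hK hKs Prod.snd continuous_snd l2 ⟨y, hy, x, hx, h⟩
    · exact hcore z K hK hKs Prod.snd continuous_snd l2 ⟨x, hx, y, hy, by linarith⟩
  obtain ⟨u, hu, u', hu', hfar⟩ := key
  cases j with
  | ofNat n => exact absurd hj (not_lt.2 (Int.natCast_nonneg n))
  | negSucc n =>
    have h1 := hfar (n + 1)
    refine lt_of_lt_of_le ?_ (Metric.edist_le_ediam_of_mem (mem_image_of_mem _ hu)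
      (mem_image_of_mem _ hu'))
    rw [edist_dist]
    refine (ENNReal.ofReal_lt_ofReal_iff_of_nonneg hd.le).2 ?_
    exact lt_of_lt_of_le (by linarith) h1
end
end
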